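/- arXiv:2307.09453 — 2 statements merged into one kernel-verified Lean document; each statement's English description precedes it below -/
import Mathlib

section
/- Let N ≥ 3 be odd and let (S,E) be the cycle of length N. For every B in phi(Vbar) one has eps(B) in M_B; the map B ↦ eps(B) is a bijection from phi(Vbar) onto V_0; and V_0 equals the union of the subspaces M_B over all B in phi(Vbar). -/
/-- The induced subgraph of `adj` on `I` is a path (type `A_m`, `m ≥ 1`):
there is an injective enumeration `f : Fin (m+1) → S` of `I` such that two
elements of `I` are adjacent iff they are consecutive in the enumeration. -/
def IsPathOn {S : Type} [DecidableEq S] (adj : S → S → Prop) (I : Finset S) : Prop :=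
  ∃ (m : ℕ) (f : Fin (m + 1) → S), Function.Injective f ∧
    I = Finset.image f Finset.univ ∧
    ∀ i j : Fin (m + 1), adj (f i) (f j) ↔ ((i : ℕ) + 1 = (j : ℕ) ∨ (j : ℕ) + 1 = (i : ℕ))

/-- The induced subgraph of `adj` on `I` is connected. -/
def ConnOn {S : Type} (adj : S → S → Prop) (I : Finset S) : Prop :=
  ∀ s ∈ I, ∀ t ∈ I, Relation.ReflTransGen (fun a b => a ∈ I ∧ b ∈ I ∧ adj a b) s t

/-- `I ∈ Cal_I^1`: the induced subgraph on `I` is a path and `|I|` is odd. -/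
def CalI1 {S : Type} [DecidableEq S] (adj : S → S → Prop) (I : Finset S) : Prop :=
  IsPathOn adj I ∧ Odd I.card

/-- `I ≺ I'`. -/
def Prec {S : Type} [DecidableEq S] (adj : S → S → Prop) (I I' : Finset S) : Prop :=
  I ⊂ I' ∧ ¬ ConnOn adj (I' \ I)

/-- `I ♠ I'`. -/
def Spade {S : Type} [DecidableEq S] (adj : S → S → Prop) (I I' : Finset S) : Prop :=
  I ∩ I' = ∅ ∧ ¬ ConnOn adj (I ∪ I')

/-- `I^{ev}`: the set of `s ∈ I` such that `I ∖ {s}` is the disjoint union of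
`I', I'' ∈ Cal_I^1` with `I' ♠ I''`. -/
def Iev {S : Type} [DecidableEq S] (adj : S → S → Prop) (I : Finset S) : Set S :=
  {s | s ∈ I ∧ ∃ I' I'' : Finset S, CalI1 adj I' ∧ CalI1 adj I'' ∧
    Spade adj I' I'' ∧ I.erase s = I' ∪ I''}

/-- Property (P0). -/
def P0 {S : Type} [DecidableEq S] (adj : S → S → Prop) (B : Finset (Finset S)) : Prop :=
  ∀ I ∈ B, ∀ I' ∈ B, I = I' ∨ Spade adj I I' ∨ Prec adj I I' ∨ Prec adj I' I

/-- Property (P1). -/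
def P1 {S : Type} [DecidableEq S] (adj : S → S → Prop) (B : Finset (Finset S)) : Prop :=
  ∀ I ∈ B, ∃ (k : ℕ) (f : Fin k → Finset S),
    (∀ j, f j ∈ B ∧ Prec adj (f j) I) ∧
    (∀ j j', j ≠ j' → Disjoint (f j) (f j')) ∧
    Iev adj I ⊆ ⋃ j, ((f j : Finset S) : Set S)

/-- `phi`: finite sets `B` of elements of `Cal_I^1` satisfying (P0) and (P1). -/
def phiSet {S : Type} [DecidableEq S] (adj : S → S → Prop) : Set (Finset (Finset S)) :=
  {B | (∀ I ∈ B, CalI1 adj I) ∧ P0 adj B ∧ P1 adj B}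

/-- `supp(B)`. -/
def suppB {S : Type} [DecidableEq S] (B : Finset (Finset S)) : Finset S := B.biUnion id

/-- `g_s(B)`. -/
def gs {S : Type} [DecidableEq S] (B : Finset (Finset S)) (s : S) : ℕ :=
  (B.filter (fun I => s ∈ I)).card

/-- `e_I = ∑_{s ∈ I} e_s`. -/
def eSum {S : Type} {V : Type} [AddCommGroup V] [Module (ZMod 2) V]
    (e : S → V) (I : Finset S) : V := ∑ s ∈ I, e s

/-- `L_B`: the `F`-span of `{e_I : I ∈ B}`. -/
def LB {S : Type} {V : Type} [AddCommGroup V] [Module (ZMod 2) V]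
    (e : S → V) (B : Finset (Finset S)) : Submodule (ZMod 2) V :=
  Submodule.span (ZMod 2) ((fun I => eSum e I) '' (B : Set (Finset S)))

/-- `eps(B) = ∑_{s ∈ S} ((g_s(B)(g_s(B)+1)/2) mod 2) e_s`. -/
def epsB {S : Type} [DecidableEq S] [Fintype S] {V : Type} [AddCommGroup V]
    [Module (ZMod 2) V] (e : S → V) (B : Finset (Finset S)) : V :=
  ∑ s : S, ((gs B s * (gs B s + 1) / 2 : ℕ) : ZMod 2) • e s

/-- The triple `(V, <,>, e)` (with graph `adj`) is perfect. -/
def IsPerfect {S : Type} [DecidableEq S] [Fintype S] {V : Type} [AddCommGroup V]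
    [Module (ZMod 2) V] (adj : S → S → Prop) (e : S → V) : Prop :=
  (∀ B ∈ phiSet adj,
      (LinearIndependent (ZMod 2) (fun I : {I : Finset S // I ∈ B} => eSum e I.1)) ∧
      (∀ I : Finset S, CalI1 adj I → (eSum e I ∈ LB e B ↔ I ∈ B))) ∧
  (∀ B ∈ phiSet adj, epsB e B ∈ LB e B) ∧
  Set.BijOn (epsB e) (phiSet adj) (⋃ B ∈ phiSet adj, ((LB e B : Submodule (ZMod 2) V) : Set V)) ∧
  (∀ B ∈ phiSet adj, ∀ B' ∈ phiSet adj, epsB e B' ∈ LB e B → ∀ s : S, gs B' s ≤ gs B s)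
/-- Adjacency of the cycle of length `N` on `S = ZMod N`. -/
def cadj (N : ℕ) (i j : ZMod N) : Prop := j = i + 1 ∨ i = j + 1

/-- `V = F^S` for `S = ZMod N`. -/
abbrev Vc (N : ℕ) := ZMod N → ZMod 2

/-- The standard basis vector `e_s`. -/
def eVec (N : ℕ) (s : ZMod N) : Vc N := Pi.single s 1

/-- The line `F·e_S`, where `e_S = ∑_{s ∈ S} e_s`. -/
def radN (N : ℕ) [NeZero N] : Submodule (ZMod 2) (Vc N) :=
  Submodule.span (ZMod 2) {eSum (eVec N) Finset.univ}

/-- `Vbar = V / (F·e_S)`. -/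
abbrev VbarN (N : ℕ) [NeZero N] := Vc N ⧸ radN N

/-- The quotient map `pi : V → Vbar`. -/
def piQ (N : ℕ) [NeZero N] : Vc N →ₗ[ZMod 2] VbarN N := (radN N).mkQ

/-- `ebar_s = pi(e_s)`. -/
def ebar (N : ℕ) [NeZero N] (s : ZMod N) : VbarN N := piQ N (eVec N s)
open scoped Classical in
/-- The connected component of `s` in the induced subgraph of `adj` on `I`. -/
noncomputable def compOf {S : Type} [DecidableEq S] (adj : S → S → Prop)
    (I : Finset S) (s : S) : Finset S :=
  I.filter (fun t => Relation.ReflTransGen (fun a b => a ∈ I ∧ b ∈ I ∧ adj a b) s t)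

/-- `c(I)`: the set of vertex sets of connected components of the induced subgraph on `I`. -/
noncomputable def comps {S : Type} [DecidableEq S] (adj : S → S → Prop)
    (I : Finset S) : Finset (Finset S) :=
  I.image (compOf adj I)

/-- `|c^0(I)|`: the number of connected components of even cardinality. -/
noncomputable def c0card {S : Type} [DecidableEq S] (adj : S → S → Prop)
    (I : Finset S) : ℕ :=
  ((comps adj I).filter (fun C => Even C.card)).card

/-- `V_0 = {e_I : I ⊊ S with |c^0(I)| even}`. -/
def V0set (N : ℕ) [NeZero N] : Set (Vc N) :=
  {v | ∃ I : Finset (ZMod N), I ≠ Finset.univ ∧ Even (c0card (cadj N) I) ∧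
    v = eSum (eVec N) I}

/-- `V_1 = {e_S} ∪ {e_I : ∅ ≠ I ⊊ S with |c^0(I)| odd}`. -/
def V1set (N : ℕ) [NeZero N] : Set (Vc N) :=
  {v | v = eSum (eVec N) Finset.univ ∨ ∃ I : Finset (ZMod N), I ≠ ∅ ∧ I ≠ Finset.univ ∧
    Odd (c0card (cadj N) I) ∧ v = eSum (eVec N) I}
open scoped Classical in
/-- `I^{odd} = I ∖ I^{ev}` (as a `Finset`). -/
noncomputable def IoddF {S : Type} [DecidableEq S] (adj : S → S → Prop)
    (I : Finset S) : Finset S :=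
  I.filter (fun s => s ∉ Iev adj I)

/-- `n_B = |{I ∈ B : ee ⊆ I}|`. -/
def nB {S : Type} [DecidableEq S] (ee : Finset S) (B : Finset (Finset S)) : ℕ :=
  (B.filter (fun I => ee ⊆ I)).card

open scoped Classical in
/-- `B ↦ B^!`: remove the unique `I_B ∈ B` with `|I_B ∩ ee| = 1` when `n_B` is odd;
leave `B` unchanged when `n_B` is even. -/
noncomputable def bangF {S : Type} [DecidableEq S] (ee : Finset S)
    (B : Finset (Finset S)) : Finset (Finset S) :=
  if h : Odd (nB ee B) ∧ ∃ I ∈ B, (I ∩ ee).card = 1 then B.erase h.2.choose else B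

/-- `omega = {B^! : B ∈ phi}`. -/
def omegaSet {S : Type} [DecidableEq S] (adj : S → S → Prop) (ee : Finset S) :
    Set (Finset (Finset S)) :=
  (bangF ee) '' (phiSet adj)

open scoped Classical in
/-- `Btilde`: the unique element of `phi` with `Btilde^! = B`. -/
noncomputable def tildeF {S : Type} [DecidableEq S] (adj : S → S → Prop) (ee : Finset S)
    (C : Finset (Finset S)) : Finset (Finset S) :=
  if h : ∃ B ∈ phiSet adj, bangF ee B = C then h.choose else ∅

/-- `'eps(B) = eps(Btilde)`. -/
noncomputable def epsO {S : Type} [DecidableEq S] [Fintype S] {V : Type} [AddCommGroup V]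
    [Module (ZMod 2) V] (adj : S → S → Prop) (ee : Finset S) (e : S → V)
    (C : Finset (Finset S)) : V :=
  epsB e (tildeF adj ee C)

/-- `B' ⪯ B` on `omega`. -/
def preceqO {S : Type} [DecidableEq S] [Fintype S] {V : Type} [AddCommGroup V]
    [Module (ZMod 2) V] (adj : S → S → Prop) (ee : Finset S) (e : S → V)
    (B' B : Finset (Finset S)) : Prop :=
  ∃ (k : ℕ) (c : ℕ → Finset (Finset S)), c 0 = B' ∧ c k = B ∧
    (∀ i ≤ k, c i ∈ omegaSet adj ee) ∧
    (∀ i < k, epsO adj ee e (c i) ∈ LB e (c (i + 1)))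

/-- The linear form `v ↦ v t + v t'` on `V`. -/
def zeeV (N : ℕ) (t t' : ZMod N) : Vc N →ₗ[ZMod 2] ZMod 2 :=
  (LinearMap.proj t : Vc N →ₗ[ZMod 2] ZMod 2) + (LinearMap.proj t' : Vc N →ₗ[ZMod 2] ZMod 2)

/-- `z_ee : Vbar → F`, the linear map with `z_ee(ebar_s) = 1` iff `s ∈ ee = {t,t'}`. -/
noncomputable def zee (N : ℕ) [NeZero N] (t t' : ZMod N) : VbarN N →ₗ[ZMod 2] ZMod 2 :=
  Submodule.liftQ (radN N) (zeeV N t t') (by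
    rw [radN, Submodule.span_le, Set.singleton_subset_iff]
    have h1 : ∀ u : ZMod N, (eSum (eVec N) Finset.univ) u = 1 := by
      intro u
      simp [eSum, eVec, Finset.sum_apply, Finset.sum_pi_single]
    simp only [SetLike.mem_coe, LinearMap.mem_ker, zeeV, LinearMap.add_apply,
      LinearMap.proj_apply, h1]
    decide)
/-- The maximal elements of a finite family of finsets, under inclusion. -/
def maxElts {S : Type} [DecidableEq S] (C : Finset (Finset S)) : Finset (Finset S) :=
  C.filter (fun I => ∀ I' ∈ C, ¬ I ⊂ I')

/-- `restB B k = B ∖ (B_1 ∪ … ∪ B_k)`: what remains of `B` after removing the first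
`k` layers; the `k`-th layer (`k ≥ 1`) is `B_k = maxElts (restB B (k-1))`. -/
def restB {S : Type} [DecidableEq S] (B : Finset (Finset S)) : ℕ → Finset (Finset S)
  | 0 => B
  | k + 1 => restB B k \ maxElts (restB B k)

/-- The relation `B' ≤ B` on `phi(V)`. -/
def lePhi {S : Type} [DecidableEq S] [Fintype S] {V : Type} [AddCommGroup V]
    [Module (ZMod 2) V] (adj : S → S → Prop) (e : S → V)
    (B' B : Finset (Finset S)) : Prop :=
  ∃ (k : ℕ) (c : ℕ → Finset (Finset S)), c 0 = B' ∧ c k = B ∧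
    (∀ i ≤ k, c i ∈ phiSet adj) ∧
    (∀ i < k, epsB e (c i) ∈ LB e (c (i + 1)))


namespace CycP

set_option linter.unusedVariables false

open Finset

theorem val_succ {N : ℕ} [NeZero N] (hN : 3 ≤ N) (x : ZMod N) :
    (x.val + 1 < N ∧ (x + 1).val = x.val + 1) ∨ (x.val + 1 = N ∧ (x + 1).val = 0) := by
  have hx := ZMod.val_lt x
  have h1 : (1 : ZMod N).val = 1 := by
    rw [ZMod.val_one_eq_one_mod]; exact Nat.mod_eq_of_lt (by omega)
  have h := ZMod.val_add x 1
  rw [h1] at h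
  rcases Nat.lt_or_ge (x.val + 1) N with h2 | h2
  · left; rw [Nat.mod_eq_of_lt h2] at h; exact ⟨h2, h⟩
  · right
    have : x.val + 1 = N := by omega
    rw [this, Nat.mod_self] at h
    exact ⟨this, h⟩

theorem sub_succ {N : ℕ} [NeZero N] (hN : 3 ≤ N) (s a : ZMod N) :
    ((s - a).val + 1 < N ∧ (s + 1 - a).val = (s - a).val + 1) ∨
      ((s - a).val + 1 = N ∧ (s + 1 - a).val = 0) := by
  have := val_succ hN (s - a)
  rwa [show s - a + 1 = s + 1 - a by ring] at this

theorem sub_pred {N : ℕ} [NeZero N] (hN : 3 ≤ N) (s a : ZMod N) :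
    (0 < (s - a).val ∧ (s - 1 - a).val + 1 = (s - a).val) ∨
      ((s - a).val = 0 ∧ (s - 1 - a).val + 1 = N) := by
  have := sub_succ hN (s - 1) a
  rw [show s - 1 + 1 = s by ring] at this
  omega

theorem sub_change {N : ℕ} [NeZero N] (t a b : ZMod N) :
    ((b - a).val ≤ (t - a).val ∧ (t - b).val + (b - a).val = (t - a).val) ∨
      ((t - a).val < (b - a).val ∧ (t - b).val + (b - a).val = (t - a).val + N) := by
  have h := ZMod.val_add (t - b) (b - a)
  rw [show t - b + (b - a) = t - a by ring] at h
  have h1 := ZMod.val_lt (t - b)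
  have h2 := ZMod.val_lt (b - a)
  rcases Nat.lt_or_ge ((t - b).val + (b - a).val) N with h3 | h3
  · rw [Nat.mod_eq_of_lt h3] at h; omega
  · rw [Nat.mod_eq_sub_mod h3, Nat.mod_eq_of_lt (by omega)] at h; omega

theorem val_cast_add {N : ℕ} [NeZero N] (a : ZMod N) {i : ℕ} (hi : i < N) :
    (a + (i : ZMod N) - a).val = i := by
  rw [add_sub_cancel_left, ZMod.val_cast_of_lt hi]

theorem cast_val_sub {N : ℕ} [NeZero N] (a s : ZMod N) :
    a + (((s - a).val : ℕ) : ZMod N) = s := by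
  rw [ZMod.natCast_zmod_val]; ring

theorem eq_of_val_sub {N : ℕ} [NeZero N] {a s t : ZMod N} (h : (s - a).val = (t - a).val) :
    s = t := by
  rw [← cast_val_sub a s, h, cast_val_sub]

/-- The arc starting at `a` with `l` elements. -/
def arc {N : ℕ} [NeZero N] (a : ZMod N) (l : ℕ) : Finset (ZMod N) :=
  Finset.univ.filter (fun s => (s - a).val < l)

theorem mem_arc {N : ℕ} [NeZero N] {a s : ZMod N} {l : ℕ} : s ∈ arc a l ↔ (s - a).val < l := by
  simp [arc]

theorem arc_eq_image {N : ℕ} [NeZero N] (a : ZMod N) {l : ℕ} (hl : l ≤ N) :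
    arc a l = (Finset.range l).image (fun i : ℕ => a + (i : ZMod N)) := by
  ext s
  simp only [mem_arc, Finset.mem_image, Finset.mem_range]
  constructor
  · intro h; exact ⟨_, h, cast_val_sub a s⟩
  · rintro ⟨i, hi, rfl⟩
    rw [val_cast_add a (by omega)]; exact hi

theorem card_arc {N : ℕ} [NeZero N] (a : ZMod N) {l : ℕ} (hl : l ≤ N) :
    (arc a l).card = l := by
  rw [arc_eq_image a hl, Finset.card_image_of_injOn, Finset.card_range]
  intro i hi j hj h
  simp only [Finset.coe_range, Set.mem_Iio] at hi hj
  have h1 := val_cast_add a (show i < N by omega)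
  have h2 := val_cast_add a (show j < N by omega)
  simp only at h
  rw [← h1, ← h2, h]

theorem arc_ind {N : ℕ} [NeZero N] (hN : 3 ≤ N) {a : ZMod N} {l : ℕ} (hl : l ≤ N)
    (P : ZMod N → Prop) {s : ZMod N} (hs : s ∈ arc a l) (hP : P s)
    (hu : ∀ t ∈ arc a l, P t → t + 1 ∈ arc a l → P (t + 1))
    (hd : ∀ t ∈ arc a l, P t → t - 1 ∈ arc a l → P (t - 1)) :
    ∀ t ∈ arc a l, P t := by
  have down : ∀ n : ℕ, ∀ t ∈ arc a l, (t - a).val = n → P t → P a := by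
    intro n
    induction n with
    | zero =>
      intro t ht h0 hp
      have : t - a = 0 := by rwa [ZMod.val_eq_zero] at h0
      rwa [← sub_eq_zero.mp this]
    | succ n ih =>
      intro t ht h0 hp
      have h := sub_pred hN t a
      have hm : t - 1 ∈ arc a l := by rw [mem_arc] at ht ⊢; omega
      exact ih (t - 1) hm (by omega) (hd t ht hp hm)
  have hPa := down _ s hs rfl hP
  have up : ∀ n : ℕ, ∀ t ∈ arc a l, (t - a).val = n → P t := by
    intro n
    induction n with
    | zero =>
      intro t ht h0
      have : t - a = 0 := by rwa [ZMod.val_eq_zero] at h0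
      rwa [sub_eq_zero.mp this]
    | succ n ih =>
      intro t ht h0
      have h := sub_pred hN t a
      have hm : t - 1 ∈ arc a l := by rw [mem_arc] at ht ⊢; omega
      have := hu (t - 1) hm (ih _ hm (by omega)) (by rwa [sub_add_cancel])
      rwa [sub_add_cancel] at this
  exact fun t ht => up _ t ht rfl

theorem conn_arc {N : ℕ} [NeZero N] (hN : 3 ≤ N) (a : ZMod N) {l : ℕ} (hl : l ≤ N) :
    ConnOn (cadj N) (arc a l) := by
  intro s hs
  apply arc_ind hN hl _ hs Relation.ReflTransGen.refl
  · intro t ht h1 h2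
    exact h1.tail ⟨ht, h2, Or.inl rfl⟩
  · intro t ht h1 h2
    exact h1.tail ⟨ht, h2, Or.inr (by ring)⟩

theorem calI1_arc {N : ℕ} [NeZero N] (hN : 3 ≤ N) (a : ZMod N) {l : ℕ} (hl : l < N)
    (ho : Odd l) : CalI1 (cadj N) (arc a l) := by
  refine ⟨?_, by rwa [card_arc a hl.le]⟩
  obtain ⟨k, hk⟩ := ho
  refine ⟨2 * k, fun i => a + ((i : ℕ) : ZMod N), ?_, ?_, ?_⟩
  · intro i j h
    have h1 := val_cast_add a (show (i : ℕ) < N by omega)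
    have h2 := val_cast_add a (show (j : ℕ) < N by omega)
    simp only at h
    apply Fin.ext
    rw [← h1, ← h2, h]
  · rw [arc_eq_image a hl.le]
    ext s
    simp only [Finset.mem_image, Finset.mem_range, Finset.mem_univ, true_and]
    constructor
    · rintro ⟨i, hi, rfl⟩; exact ⟨⟨i, by omega⟩, rfl⟩
    · rintro ⟨i, rfl⟩; exact ⟨i, by omega, rfl⟩
  · intro i j
    have h1 := val_cast_add a (show (i : ℕ) < N by omega)
    have h2 := val_cast_add a (show (j : ℕ) < N by omega)
    have h3 := val_cast_add a (show (i : ℕ) + 1 < N by omega)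
    have h4 := val_cast_add a (show (j : ℕ) + 1 < N by omega)
    simp only [cadj]
    constructor
    · rintro (h | h)
      · left
        rw [h, show a + ((i : ℕ) : ZMod N) + 1 = a + (((i : ℕ) + 1 : ℕ) : ZMod N) by
          push_cast; ring] at h2
        omega
      · right
        rw [h, show a + ((j : ℕ) : ZMod N) + 1 = a + (((j : ℕ) + 1 : ℕ) : ZMod N) by
          push_cast; ring] at h1
        omega
    · rintro (h | h)
      · left; rw [← h]; push_cast; ring
      · right; rw [← h]; push_cast; ring

theorem arc_of_calI1 {N : ℕ} [NeZero N] (hN : 3 ≤ N) {I : Finset (ZMod N)}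
    (h : CalI1 (cadj N) I) : ∃ a l, l < N ∧ Odd l ∧ I = arc a l := by
  obtain ⟨⟨m, f, hinj, hI, hadj⟩, hodd⟩ := h
  have hcard : I.card = m + 1 := by
    rw [hI, Finset.card_image_of_injective _ hinj]; simp
  have hle : m + 1 ≤ N := by
    rw [← hcard]
    have := Finset.card_le_univ I
    rwa [ZMod.card] at this
  rw [hcard] at hodd
  -- it suffices to find a straight enumeration
  suffices key : ∃ (F : ℕ → ZMod N) (a : ZMod N), (∀ i ≤ m, F i = a + i) ∧
      (∀ s, s ∈ I ↔ ∃ i ≤ m, F i = s) ∧ (2 ≤ m → ¬ cadj N (F 0) (F m)) by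
    obtain ⟨F, a, hF, hFI, hna⟩ := key
    have hlt : m + 1 ≠ N := by
      intro hmN
      apply hna (by omega)
      rw [hF 0 (by omega), hF m le_rfl]
      right
      have : ((m + 1 : ℕ) : ZMod N) = 0 := by rw [hmN]; exact ZMod.natCast_self N
      push_cast at this
      rw [add_assoc, this]; simp
    refine ⟨a, m + 1, by omega, hodd, ?_⟩
    rw [arc_eq_image a hle]
    ext s
    rw [hFI]
    simp only [Finset.mem_image, Finset.mem_range]
    constructor
    · rintro ⟨i, hi, rfl⟩; exact ⟨i, by omega, (hF i hi).symm⟩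
    · rintro ⟨i, hi, rfl⟩; exact ⟨i, by omega, hF i (by omega)⟩
  obtain ⟨F, hFf⟩ : ∃ F : ℕ → ZMod N, ∀ i : Fin (m + 1), F i = f i :=
    ⟨fun i => if h : i < m + 1 then f ⟨i, h⟩ else 0, fun i => by simp only [i.2, dif_pos]⟩
  have hFinj : ∀ i ≤ m, ∀ j ≤ m, F i = F j → i = j := by
    intro i hi j hj h
    have h1 := hFf ⟨i, by omega⟩
    have h2 := hFf ⟨j, by omega⟩
    simp only at h1 h2
    rw [h1, h2] at h
    have := hinj h
    simpa using this
  have hFadj : ∀ i ≤ m, ∀ j ≤ m, (cadj N (F i) (F j) ↔ (i + 1 = j ∨ j + 1 = i)) := by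
    intro i hi j hj
    have h1 := hFf ⟨i, by omega⟩
    have h2 := hFf ⟨j, by omega⟩
    simp only at h1 h2
    rw [h1, h2, hadj]
  have hFI : ∀ s, s ∈ I ↔ ∃ i ≤ m, F i = s := by
    intro s
    rw [hI]
    simp only [Finset.mem_image, Finset.mem_univ, true_and]
    constructor
    · rintro ⟨i, rfl⟩; exact ⟨i, by omega, hFf i⟩
    · rintro ⟨i, hi, rfl⟩; exact ⟨⟨i, by omega⟩, (hFf ⟨i, by omega⟩).symm⟩
  have hna : 2 ≤ m → ¬ cadj N (F 0) (F m) := by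
    intro hm h
    rw [hFadj 0 (by omega) m le_rfl] at h
    omega
  have hna' : 2 ≤ m → ¬ cadj N (F m) (F 0) := by
    intro hm h
    rw [hFadj m le_rfl 0 (by omega)] at h
    omega
  rcases Nat.eq_zero_or_pos m with rfl | hm
  · refine ⟨F, F 0, ?_, hFI, hna⟩
    intro i hi
    have : i = 0 := by omega
    subst this; simp
  rcases (hFadj 0 (by omega) 1 (by omega)).mpr (Or.inl rfl) with h01 | h01
  · refine ⟨F, F 0, ?_, hFI, hna⟩
    intro i
    induction i using Nat.strong_induction_on with
    | _ i ih =>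
      intro hi
      match i, ih, hi with
      | 0, _, _ => simp
      | 1, _, _ => rw [h01]; simp
      | i + 2, ih, hi =>
        have e1 := ih (i + 1) (by omega) (by omega)
        have e0 := ih i (by omega) (by omega)
        rcases (hFadj (i + 1) (by omega) (i + 2) hi).mpr (Or.inl rfl) with h | h
        · rw [h, e1]; push_cast; ring
        · exfalso
          have : F (i + 2) = F i := by
            have h3 : F (i + 2) = F (i + 1) - 1 := by rw [h]; ring
            rw [h3, e1, e0]; push_cast; ring
          have := hFinj _ hi _ (by omega) this
          omega
  · have hall : ∀ i ≤ m, F i = F 0 - i := by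
      intro i
      induction i using Nat.strong_induction_on with
      | _ i ih =>
        intro hi
        match i, ih, hi with
        | 0, _, _ => simp
        | 1, _, _ => rw [h01]; simp
        | i + 2, ih, hi =>
          have e1 := ih (i + 1) (by omega) (by omega)
          have e0 := ih i (by omega) (by omega)
          rcases (hFadj (i + 1) (by omega) (i + 2) hi).mpr (Or.inl rfl) with h | h
          · exfalso
            have : F (i + 2) = F i := by
              rw [h, e1, e0]; push_cast; ring
            have := hFinj _ hi _ (by omega) this
            omega
          · have h3 : F (i + 2) = F (i + 1) - 1 := by rw [h]; ring
            rw [h3, e1]; push_cast; ring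
    refine ⟨fun i => F (m - i), F 0 - m, ?_, ?_, ?_⟩
    · intro i hi
      simp only
      rw [hall (m - i) (by omega), Nat.cast_sub hi]; ring
    · intro s
      rw [hFI]
      constructor
      · rintro ⟨i, hi, rfl⟩
        exact ⟨m - i, by omega, by simp only; congr 1; omega⟩
      · rintro ⟨i, hi, rfl⟩
        exact ⟨m - i, by omega, rfl⟩
    · simpa using hna'

theorem arc_start {N : ℕ} [NeZero N] (hN : 3 ≤ N) {a s : ZMod N} {l : ℕ} (hl : l < N)
    (hs : s ∈ arc a l) (h : s - 1 ∉ arc a l) : s = a := by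
  rw [mem_arc] at hs h
  have h1 := sub_pred hN s a
  have h0 : (s - a).val = 0 := by omega
  rw [ZMod.val_eq_zero] at h0
  exact sub_eq_zero.mp h0

theorem arc_end {N : ℕ} [NeZero N] (hN : 3 ≤ N) {a s : ZMod N} {l : ℕ} (hl : l < N)
    (hs : s ∈ arc a l) (h : s + 1 ∉ arc a l) : (s - a).val + 1 = l := by
  rw [mem_arc] at hs h
  have h1 := sub_succ hN s a
  omega

theorem prec_iff {N : ℕ} [NeZero N] (hN : 3 ≤ N) {I J : Finset (ZMod N)}
    (hI : CalI1 (cadj N) I) (hJ : CalI1 (cadj N) J) :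
    Prec (cadj N) I J ↔ (I ⊆ J ∧ ∀ s ∈ I, s + 1 ∈ J ∧ s - 1 ∈ J) := by
  obtain ⟨b, m, hm, hmo, rfl⟩ := arc_of_calI1 hN hI
  obtain ⟨a, l, hl, hlo, rfl⟩ := arc_of_calI1 hN hJ
  have hm0 : 0 < m := hmo.pos
  have hl0 : 0 < l := hlo.pos
  constructor
  · rintro ⟨hsub, hconn⟩
    have hsub' := hsub.1
    have hml : m ≤ l := by
      have := Finset.card_le_card hsub'
      rwa [card_arc _ hm.le, card_arc _ hl.le] at this
    refine ⟨hsub', ?_⟩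
    intro s hs
    have hsJ := hsub' hs
    by_contra hcon
    apply hconn
    by_cases hu : s + 1 ∈ arc a l
    · have hd : s - 1 ∉ arc a l := fun h => hcon ⟨hu, h⟩
      have e1 := arc_start hN hl hsJ hd
      have e2 := arc_start hN hm hs (fun h => hd (hsub' h))
      have : arc a l \ arc b m = arc (a + (m : ZMod N)) (l - m) := by
        ext t
        rw [Finset.mem_sdiff, mem_arc, mem_arc, mem_arc]
        rw [← e2, e1]
        have h1 := sub_change t a (a + (m : ZMod N))
        rw [val_cast_add a hm] at h1
        have h2 := ZMod.val_lt (t - (a + (m : ZMod N)))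
        have h3 := ZMod.val_lt (t - a)
        omega
      rw [this]
      exact conn_arc hN _ (by omega)
    · have e1 := arc_end hN hl hsJ hu
      have e2 := arc_end hN hm hs (fun h => hu (hsub' h))
      have : arc a l \ arc b m = arc a (l - m) := by
        ext t
        rw [Finset.mem_sdiff, mem_arc, mem_arc, mem_arc]
        have h1 := sub_change t a b
        have h4 := sub_change s a b
        have h2 := ZMod.val_lt (t - b)
        have h3 := ZMod.val_lt (t - a)
        omega
      rw [this]
      exact conn_arc hN _ (by omega)
  · rintro ⟨hsub, hint⟩
    have haJ : a ∈ arc a l := by rw [mem_arc]; simpa using hl0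
    have ha1 : a - 1 ∉ arc a l := by
      rw [mem_arc]
      have := sub_pred hN a a
      simp only [sub_self, ZMod.val_zero] at this
      omega
    have haI : a ∉ arc b m := fun h => ha1 (hint a h).2
    refine ⟨⟨hsub, fun h => haI (h haJ)⟩, ?_⟩
    intro hconn
    set e : ZMod N := a + ((l - 1 : ℕ) : ZMod N) with he
    have hev : (e - a).val = l - 1 := val_cast_add a (by omega)
    have heJ : e ∈ arc a l := by rw [mem_arc]; omega
    have heI : e ∉ arc b m := by
      intro h
      have := (hint e h).1
      rw [mem_arc] at this
      have := sub_succ hN e a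
      omega
    have hbI : b ∈ arc b m := by rw [mem_arc]; simpa using hm0
    have hbJ := hsub hbI
    have hpath := hconn a (by simp [haJ, haI]) e (by simp [heJ, heI])
    have inv : ∀ t, Relation.ReflTransGen (fun x y => x ∈ arc a l \ arc b m ∧
        y ∈ arc a l \ arc b m ∧ cadj N x y) a t → (t - a).val < (b - a).val := by
      intro t ht
      induction ht with
      | refl =>
        rw [sub_self, ZMod.val_zero]
        rcases Nat.eq_zero_or_pos (b - a).val with h0 | h0
        · rw [ZMod.val_eq_zero, sub_eq_zero] at h0
          rw [h0] at hbI; exact absurd (h0 ▸ hbI) haI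
        · exact h0
      | @tail x y _ hxy ih =>
        obtain ⟨hx, hy, hxy⟩ := hxy
        rw [Finset.mem_sdiff] at hx hy
        have hyb : (y - a).val ≠ (b - a).val := by
          intro h
          exact hy.2 (eq_of_val_sub h ▸ hbI)
        have hyJ := hy.1
        rw [mem_arc] at hyJ
        rcases hxy with rfl | rfl
        · have := sub_succ hN x a
          omega
        · have := sub_succ hN y a
          omega
    have := inv e hpath
    rw [mem_arc] at hbJ
    omega

theorem spade_iff {N : ℕ} [NeZero N] (hN : 3 ≤ N) {I J : Finset (ZMod N)}
    (hI : CalI1 (cadj N) I) (hJ : CalI1 (cadj N) J) :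
    Spade (cadj N) I J ↔ (∀ s ∈ I, s ∉ J ∧ s + 1 ∉ J ∧ s - 1 ∉ J) := by
  obtain ⟨b, m, hm, hmo, hIe⟩ := arc_of_calI1 hN hI
  obtain ⟨a, l, hl, hlo, hJe⟩ := arc_of_calI1 hN hJ
  have hm0 : 0 < m := hmo.pos
  have hl0 : 0 < l := hlo.pos
  constructor
  · rintro ⟨hdis, hconn⟩ s hs
    have hsJ : s ∉ J := fun h => by
      have : s ∈ I ∩ J := Finset.mem_inter.mpr ⟨hs, h⟩
      rw [hdis] at this; simp at this
    refine ⟨hsJ, ?_⟩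
    by_contra hcon
    have hex : ∃ t ∈ J, cadj N s t := by
      by_cases h : s + 1 ∈ J
      · exact ⟨_, h, Or.inl rfl⟩
      · have : s - 1 ∈ J := by by_contra h'; exact hcon ⟨h, h'⟩
        exact ⟨_, this, Or.inr (by ring)⟩
    obtain ⟨t, ht, hst⟩ := hex
    apply hconn
    have mono : ∀ K : Finset (ZMod N), K ⊆ I ∪ J → ConnOn (cadj N) K → ∀ x ∈ K, ∀ y ∈ K,
        Relation.ReflTransGen (fun a b => a ∈ I ∪ J ∧ b ∈ I ∪ J ∧ cadj N a b) x y := by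
      intro K hK hc x hx y hy
      have hxy := hc x hx y hy
      induction hxy with
      | refl => exact Relation.ReflTransGen.refl
      | tail _ h ih => exact (ih h.1).tail ⟨hK h.1, hK h.2.1, h.2.2⟩
    have cI := mono I Finset.subset_union_left (hIe ▸ conn_arc hN b hm.le)
    have cJ := mono J Finset.subset_union_right (hJe ▸ conn_arc hN a hl.le)
    have hsU : s ∈ I ∪ J := Finset.mem_union_left _ hs
    have htU : t ∈ I ∪ J := Finset.mem_union_right _ ht
    have e1 : Relation.ReflTransGen (fun a b => a ∈ I ∪ J ∧ b ∈ I ∪ J ∧ cadj N a b) s t :=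
      Relation.ReflTransGen.single ⟨hsU, htU, hst⟩
    have e2 : Relation.ReflTransGen (fun a b => a ∈ I ∪ J ∧ b ∈ I ∪ J ∧ cadj N a b) t s :=
      Relation.ReflTransGen.single ⟨htU, hsU, hst.symm⟩
    intro x hx y hy
    rcases Finset.mem_union.mp hx with hx | hx <;> rcases Finset.mem_union.mp hy with hy | hy
    · exact cI x hx y hy
    · exact ((cI x hx s hs).trans e1).trans (cJ t ht y hy)
    · exact ((cJ x hx t ht).trans e2).trans (cI s hs y hy)
    · exact cJ x hx y hy
  · intro h
    refine ⟨?_, ?_⟩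
    · ext s
      simp only [Finset.mem_inter, Finset.notMem_empty, iff_false]
      rintro ⟨h1, h2⟩
      exact (h s h1).1 h2
    · intro hconn
      have hbI : b ∈ I := by rw [hIe, mem_arc]; simpa using hm0
      have haJ : a ∈ J := by rw [hJe, mem_arc]; simpa using hl0
      have hp := hconn b (Finset.mem_union_left _ hbI) a (Finset.mem_union_right _ haJ)
      have inv : ∀ t, Relation.ReflTransGen (fun x y => x ∈ I ∪ J ∧ y ∈ I ∪ J ∧ cadj N x y)
          b t → t ∈ I := by
        intro t ht
        induction ht with
        | refl => exact hbI
        | @tail x y _ hxy ih =>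
          obtain ⟨_, hy, hxy⟩ := hxy
          rcases Finset.mem_union.mp hy with hy | hy
          · exact hy
          · exfalso
            rcases hxy with rfl | rfl
            · exact (h x ih).2.1 hy
            · have := (h _ ih).2.2
              rw [add_sub_cancel_right] at this
              exact this hy
      exact (h a (inv a hp)).1 haJ

theorem iev_of_odd {N : ℕ} [NeZero N] (hN : 3 ≤ N) {a s : ZMod N} {l : ℕ} (hl : l < N)
    (hlo : Odd l) (hs : s ∈ arc a l) (ho : Odd (s - a).val) : s ∈ Iev (cadj N) (arc a l) := by
  refine ⟨hs, arc a (s - a).val, arc (s + 1) (l - (s - a).val - 1), ?_⟩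
  rw [mem_arc] at hs
  have hne : (s - a).val + 1 ≠ l := by
    intro h; rw [← h] at hlo
    rw [Nat.odd_iff] at *; omega
  have c1 : CalI1 (cadj N) (arc a (s - a).val) := calI1_arc hN a (by omega) ho
  have c2 : CalI1 (cadj N) (arc (s + 1) (l - (s - a).val - 1)) :=
    calI1_arc hN _ (by omega) (by rw [Nat.odd_iff] at *; omega)
  have h1 := sub_succ hN s a
  refine ⟨c1, c2, ?_, ?_⟩
  · rw [spade_iff hN c1 c2]
    intro t ht
    simp only [mem_arc] at *
    have h3 := sub_change t a (s + 1)
    have h4 := sub_change (t + 1) a (s + 1)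
    have h5 := sub_change (t - 1) a (s + 1)
    have h6 := sub_succ hN t a
    have h7 := sub_pred hN t a
    omega
  · ext t
    simp only [Finset.mem_erase, Finset.mem_union, mem_arc]
    have h3 := sub_change t a (s + 1)
    have h4 : t ≠ s ↔ (t - a).val ≠ (s - a).val :=
      ⟨fun h h' => h (eq_of_val_sub h'), fun h h' => h (by rw [h'])⟩
    rw [h4]
    have := ZMod.val_lt (t - (s + 1))
    have := ZMod.val_lt (t - a)
    omega

theorem odd_of_iev {N : ℕ} [NeZero N] (hN : 3 ≤ N) {a s : ZMod N} {l : ℕ} (hl : l < N)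
    (h : s ∈ Iev (cadj N) (arc a l)) : Odd (s - a).val := by
  obtain ⟨hs, I, J, hI, hJ, hsp, hun⟩ := h
  have hconn := hsp.2
  rw [spade_iff hN hI hJ] at hsp
  have hsp' : ∀ s ∈ J, s ∉ I ∧ s + 1 ∉ I ∧ s - 1 ∉ I := by
    intro t ht
    refine ⟨fun h => (hsp t h).1 ht, fun h => ?_, fun h => ?_⟩
    · have := (hsp _ h).2.2; rw [add_sub_cancel_right] at this; exact this ht
    · have := (hsp _ h).2.1; rw [sub_add_cancel] at this; exact this ht
  rw [mem_arc] at hs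
  have key : ∀ I J : Finset (ZMod N), CalI1 (cadj N) I →
      (∀ s ∈ I, s ∉ J ∧ s + 1 ∉ J ∧ s - 1 ∉ J) → (arc a l).erase s = I ∪ J →
      (∃ t ∈ I, (t - a).val < (s - a).val) → Odd (s - a).val := by
    rintro I J hI hsp hun ⟨t, ht, hlt⟩
    have hmem : ∀ x, (x ∈ I ∨ x ∈ J) ↔ ((x - a).val ≠ (s - a).val ∧ (x - a).val < l) := by
      intro x
      rw [← Finset.mem_union, ← hun, Finset.mem_erase, mem_arc]
      have h4 : x ≠ s ↔ (x - a).val ≠ (s - a).val :=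
        ⟨fun h h' => h (eq_of_val_sub h'), fun h h' => h (by rw [h'])⟩
      rw [h4]
    have e : I = arc a (s - a).val := by
      apply Finset.Subset.antisymm
      · obtain ⟨b, m, hm, hmo, rfl⟩ := arc_of_calI1 hN hI
        have := arc_ind hN hm.le (fun x => (x - a).val < (s - a).val) ht hlt ?_ ?_
        · intro x hx; rw [mem_arc]; exact this x hx
        · intro x hx h1 h2
          have h3 := (hmem _).mp (Or.inl h2)
          have := sub_succ hN x a
          omega
        · intro x hx h1 h2
          have h3 := (hmem _).mp (Or.inl h2)
          have := sub_pred hN x a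
          omega
      · have hle : (s - a).val ≤ N := (ZMod.val_lt _).le
        apply arc_ind hN hle (fun x => x ∈ I) (mem_arc.mpr hlt) ht
        · intro x hx h1 h2
          rw [mem_arc] at h2
          rcases (hmem (x + 1)).mpr ⟨by omega, by omega⟩ with h3 | h3
          · exact h3
          · exact absurd h3 (hsp x h1).2.1
        · intro x hx h1 h2
          rw [mem_arc] at h2
          rcases (hmem (x - 1)).mpr ⟨by omega, by omega⟩ with h3 | h3
          · exact h3
          · exact absurd h3 (hsp x h1).2.2
    have := hI.2
    rwa [e, card_arc a (ZMod.val_lt _).le] at this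
  by_cases h1 : ∃ t ∈ I, (t - a).val < (s - a).val
  · exact key I J hI hsp hun h1
  by_cases h2 : ∃ t ∈ J, (t - a).val < (s - a).val
  · exact key J I hJ hsp' (by rw [hun, Finset.union_comm]) h2
  exfalso
  have h0 : (s - a).val = 0 := by
    by_contra h0
    have ha : a ∈ (arc a l).erase s := by
      rw [Finset.mem_erase, mem_arc, sub_self, ZMod.val_zero]
      refine ⟨?_, by omega⟩
      rintro rfl; simp at h0
    rw [hun, Finset.mem_union] at ha
    rcases ha with ha | ha
    · exact h1 ⟨a, ha, by rw [sub_self, ZMod.val_zero]; omega⟩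
    · exact h2 ⟨a, ha, by rw [sub_self, ZMod.val_zero]; omega⟩
  apply hconn
  rw [← hun]
  have hsa : s = a := by rw [ZMod.val_eq_zero] at h0; exact sub_eq_zero.mp h0
  have : (arc a l).erase s = arc (a + 1) (l - 1) := by
    ext t
    simp only [Finset.mem_erase, mem_arc]
    have h3 := sub_change t a (a + 1)
    have h5 := sub_succ hN a a
    rw [sub_self, ZMod.val_zero] at h5
    have h4 : t ≠ s ↔ (t - a).val ≠ (s - a).val :=
      ⟨fun h h' => h (eq_of_val_sub h'), fun h h' => h (by rw [h'])⟩
    rw [h4]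
    have := ZMod.val_lt (t - (a + 1))
    have := ZMod.val_lt (t - a)
    omega
  rw [this]
  exact conn_arc hN _ (by omega)

/-- Walk condition on a depth function. -/
def Wk {N : ℕ} (g : ZMod N → ℕ) : Prop :=
  ∀ s, g (s + 1) = g s + 1 ∨ g s = g (s + 1) + 1 ∨ (g s = 0 ∧ g (s + 1) = 0)

/-- `I` is closed off at level `k`. -/
def LC {N : ℕ} (g : ZMod N → ℕ) (k : ℕ) (I : Finset (ZMod N)) : Prop :=
  (∀ s ∈ I, k < g s) ∧ (∀ s ∈ I, s + 1 ∉ I → g (s + 1) = k) ∧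
    (∀ s ∈ I, s - 1 ∉ I → g (s - 1) = k)

theorem calI1_ind {N : ℕ} [NeZero N] (hN : 3 ≤ N) {I : Finset (ZMod N)}
    (hI : CalI1 (cadj N) I)
    (P : ZMod N → Prop) {s : ZMod N} (hs : s ∈ I) (hP : P s)
    (hu : ∀ t ∈ I, P t → t + 1 ∈ I → P (t + 1))
    (hd : ∀ t ∈ I, P t → t - 1 ∈ I → P (t - 1)) :
    ∀ t ∈ I, P t := by
  obtain ⟨a, l, hl, hlo, rfl⟩ := arc_of_calI1 hN hI
  exact arc_ind hN hl.le P hs hP hu hd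

theorem calI1_start {N : ℕ} [NeZero N] (hN : 3 ≤ N) {I : Finset (ZMod N)}
    (hI : CalI1 (cadj N) I) : ∃ a ∈ I, a - 1 ∉ I := by
  obtain ⟨a, l, hl, hlo, rfl⟩ := arc_of_calI1 hN hI
  have := hlo.pos
  refine ⟨a, by rw [mem_arc]; simpa using this, ?_⟩
  rw [mem_arc]
  have := sub_pred hN a a
  simp only [sub_self, ZMod.val_zero] at this
  omega

theorem iev_consec {N : ℕ} [NeZero N] (hN : 3 ≤ N) {I : Finset (ZMod N)}
    (hI : CalI1 (cadj N) I) {s : ZMod N} (h1 : s ∈ I) (h2 : s + 1 ∈ I) :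
    s ∈ Iev (cadj N) I ∨ s + 1 ∈ Iev (cadj N) I := by
  obtain ⟨a, l, hl, hlo, rfl⟩ := arc_of_calI1 hN hI
  rcases Nat.even_or_odd (s - a).val with h | h
  · right
    apply iev_of_odd hN hl hlo h2
    rw [mem_arc] at h1 h2
    have := sub_succ hN s a
    rw [Nat.odd_iff]; rw [Nat.even_iff] at h
    omega
  · left
    exact iev_of_odd hN hl hlo h1 h

theorem phi_p0 {N : ℕ} [NeZero N] (hN : 3 ≤ N) {B : Finset (Finset (ZMod N))}
    (hB : B ∈ phiSet (cadj N)) {I J : Finset (ZMod N)} (hI : I ∈ B) (hJ : J ∈ B) :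
    I = J ∨ (∀ s ∈ I, s ∉ J ∧ s + 1 ∉ J ∧ s - 1 ∉ J) ∨
      (I ⊆ J ∧ ∀ s ∈ I, s + 1 ∈ J ∧ s - 1 ∈ J) ∨
      (J ⊆ I ∧ ∀ s ∈ J, s + 1 ∈ I ∧ s - 1 ∈ I) := by
  obtain ⟨hc, h0, -⟩ := hB
  have := h0 I hI J hJ
  rwa [spade_iff hN (hc I hI) (hc J hJ), prec_iff hN (hc I hI) (hc J hJ),
    prec_iff hN (hc J hJ) (hc I hI)] at this

theorem gs_wk {N : ℕ} [NeZero N] (hN : 3 ≤ N) {B : Finset (Finset (ZMod N))}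
    (hB : B ∈ phiSet (cadj N)) : Wk (gs B) := by
  intro s
  set C := B.filter (fun I => s ∈ I ∧ s + 1 ∈ I) with hC
  set U := B.filter (fun I => s ∈ I ∧ s + 1 ∉ I) with hU
  set D := B.filter (fun I => s ∉ I ∧ s + 1 ∈ I) with hD
  have e1 : gs B s = C.card + U.card := by
    rw [gs, ← Finset.card_union_of_disjoint]
    · congr 1; ext I; simp only [hC, hU, Finset.mem_union, Finset.mem_filter]; tauto
    · rw [Finset.disjoint_left]; intro I; simp only [hC, hU, Finset.mem_filter]; tauto
  have e2 : gs B (s + 1) = C.card + D.card := by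
    rw [gs, ← Finset.card_union_of_disjoint]
    · congr 1; ext I; simp only [hC, hD, Finset.mem_union, Finset.mem_filter]; tauto
    · rw [Finset.disjoint_left]; intro I; simp only [hC, hD, Finset.mem_filter]; tauto
  have hU1 : U.card ≤ 1 := by
    rw [Finset.card_le_one]
    intro I hI J hJ
    simp only [hU, Finset.mem_filter] at hI hJ
    rcases phi_p0 hN hB hI.1 hJ.1 with h | h | h | h
    · exact h
    · exact absurd hJ.2.1 (h s hI.2.1).1
    · exact absurd (h.2 s hI.2.1).1 hJ.2.2
    · exact absurd (h.2 s hJ.2.1).1 hI.2.2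
  have hs1 : s + 1 - 1 = s := by ring
  have hD1 : D.card ≤ 1 := by
    rw [Finset.card_le_one]
    intro I hI J hJ
    simp only [hD, Finset.mem_filter] at hI hJ
    rcases phi_p0 hN hB hI.1 hJ.1 with h | h | h | h
    · exact h
    · exact absurd hJ.2.2 (h _ hI.2.2).1
    · have := (h.2 _ hI.2.2).2; rw [hs1] at this; exact absurd this hJ.2.1
    · have := (h.2 _ hJ.2.2).2; rw [hs1] at this; exact absurd this hI.2.1
  have hUD : U.card = 0 ∨ D.card = 0 := by
    by_contra hcon
    push Not at hcon
    obtain ⟨I, hI⟩ := Finset.card_pos.mp (Nat.pos_of_ne_zero hcon.1)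
    obtain ⟨J, hJ⟩ := Finset.card_pos.mp (Nat.pos_of_ne_zero hcon.2)
    simp only [hU, hD, Finset.mem_filter] at hI hJ
    rcases phi_p0 hN hB hI.1 hJ.1 with h | h | h | h
    · subst h; exact hJ.2.1 hI.2.1
    · exact (h s hI.2.1).2.1 hJ.2.2
    · exact hJ.2.1 (h.1 hI.2.1)
    · exact hI.2.2 (h.1 hJ.2.2)
  have hC0 : U.card = 0 → D.card = 0 → C.card = 0 := by
    intro hu hd
    by_contra hcon
    obtain ⟨I, hI, hmin⟩ := Finset.exists_min_image C Finset.card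
      (Finset.card_pos.mp (Nat.pos_of_ne_zero hcon))
    have hI' := hI
    simp only [hC, Finset.mem_filter] at hI'
    obtain ⟨hc, -, h1⟩ := id hB
    obtain ⟨n, f, hf, -, hcov⟩ := h1 I hI'.1
    have : ∃ J ∈ B, J ⊂ I ∧ (s ∈ J ∨ s + 1 ∈ J) := by
      rcases iev_consec hN (hc I hI'.1) hI'.2.1 hI'.2.2 with h | h
      · obtain ⟨j, hj⟩ := Set.mem_iUnion.mp (hcov h)
        exact ⟨f j, (hf j).1, (hf j).2.1, Or.inl hj⟩
      · obtain ⟨j, hj⟩ := Set.mem_iUnion.mp (hcov h)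
        exact ⟨f j, (hf j).1, (hf j).2.1, Or.inr hj⟩
    obtain ⟨J, hJ, hJI, hs⟩ := this
    have hJC : J ∈ C := by
      rw [Finset.card_eq_zero] at hu hd
      have h1 : J ∉ U := by rw [hu]; simp
      have h2 : J ∉ D := by rw [hd]; simp
      simp only [hU, hD, hC, Finset.mem_filter] at h1 h2 ⊢
      tauto
    have h1 := hmin J hJC
    have h2 := Finset.card_lt_card hJI
    omega
  omega

theorem lc_of_mem {N : ℕ} [NeZero N] (hN : 3 ≤ N) {B : Finset (Finset (ZMod N))}
    (hB : B ∈ phiSet (cadj N)) {I : Finset (ZMod N)} (hI : I ∈ B) :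
    ∃ k, LC (gs B) k I := by
  have hne : ∃ a, a ∈ I := by
    obtain ⟨a, ha, -⟩ := calI1_start hN (hB.1 I hI)
    exact ⟨a, ha⟩
  set K := B.filter (fun J => I ⊆ J) with hK
  have hIK : I ∈ K := by simp [hK, hI]
  have hpos : 0 < K.card := Finset.card_pos.mpr ⟨I, hIK⟩
  have out : ∀ s ∈ I, ∀ t, t ∉ I → (t = s + 1 ∨ t = s - 1) → gs B t = K.card - 1 := by
    intro s hs t ht hst
    rw [gs, ← Finset.card_erase_of_mem hIK]
    congr 1
    ext J
    simp only [hK, Finset.mem_filter, Finset.mem_erase]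
    constructor
    · rintro ⟨hJ, htJ⟩
      rcases phi_p0 hN hB hI hJ with h | h | h | h
      · subst h; exact absurd htJ ht
      · have := h s hs
        rcases hst with rfl | rfl
        · exact absurd htJ this.2.1
        · exact absurd htJ this.2.2
      · refine ⟨?_, hJ, h.1⟩
        rintro rfl; exact ht htJ
      · exact absurd (h.1 htJ) ht
    · rintro ⟨hne', hJ, hIJ⟩
      refine ⟨hJ, ?_⟩
      rcases phi_p0 hN hB hI hJ with h | h | h | h
      · exact absurd h.symm hne'
      · exact absurd (hIJ hs) (h s hs).1
      · rcases hst with rfl | rfl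
        · exact (h.2 s hs).1
        · exact (h.2 s hs).2
      · exact absurd (Finset.Subset.antisymm h.1 hIJ) hne'
  refine ⟨K.card - 1, ?_, ?_, ?_⟩
  · intro s hs
    have : K.card ≤ gs B s := by
      rw [gs]
      apply Finset.card_le_card
      intro J hJ
      simp only [hK, Finset.mem_filter] at hJ ⊢
      exact ⟨hJ.1, hJ.2 hs⟩
    omega
  · intro s hs h; exact out s hs _ h (Or.inl rfl)
  · intro s hs h; exact out s hs _ h (Or.inr rfl)

theorem lc_subset {N : ℕ} [NeZero N] (hN : 3 ≤ N) {g : ZMod N → ℕ} {k k' : ℕ}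
    {I J : Finset (ZMod N)} (hJ : CalI1 (cadj N) J)
    (h1 : LC g k I) (h2 : LC g k' J) (hk : k ≤ k') {s : ZMod N} (hsI : s ∈ I) (hsJ : s ∈ J) :
    J ⊆ I := by
  apply calI1_ind hN hJ (fun t => t ∈ I) hsJ hsI
  · intro t _ ht htJ
    by_contra hcon
    have e1 := h1.2.1 t ht hcon
    have e2 := h2.1 _ htJ
    omega
  · intro t _ ht htJ
    by_contra hcon
    have e1 := h1.2.2 t ht hcon
    have e2 := h2.1 _ htJ
    omega

theorem lc_prec {N : ℕ} [NeZero N] (hN : 3 ≤ N) {g : ZMod N → ℕ} {k k' : ℕ}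
    {I J : Finset (ZMod N)} (hI : CalI1 (cadj N) I) (hJ : CalI1 (cadj N) J)
    (h1 : LC g k I) (h2 : LC g k' J) (hk : k < k') {s : ZMod N} (hsI : s ∈ I) (hsJ : s ∈ J) :
    Prec (cadj N) J I := by
  have hsub := lc_subset hN hJ h1 h2 hk.le hsI hsJ
  rw [prec_iff hN hJ hI]
  refine ⟨hsub, ?_⟩
  intro t ht
  constructor
  · by_contra hcon
    have e1 := h1.2.1 t (hsub ht) hcon
    have e2 := h2.2.1 t ht (fun h => hcon (hsub h))
    omega
  · by_contra hcon
    have e1 := h1.2.2 t (hsub ht) hcon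
    have e2 := h2.2.2 t ht (fun h => hcon (hsub h))
    omega

theorem mem_of_lc {N : ℕ} [NeZero N] (hN : 3 ≤ N) {B : Finset (Finset (ZMod N))}
    (hB : B ∈ phiSet (cadj N)) {I : Finset (ZMod N)} (hI : CalI1 (cadj N) I) {k : ℕ}
    (h : LC (gs B) k I) : I ∈ B := by
  obtain ⟨a, ha, ha1⟩ := calI1_start hN hI
  have e1 := h.1 a ha
  have e2 := h.2.2 a ha ha1
  have : ∃ J ∈ B, a ∈ J ∧ a - 1 ∉ J := by
    by_contra hcon
    push Not at hcon
    have : gs B a ≤ gs B (a - 1) := by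
      apply Finset.card_le_card
      intro J hJ
      simp only [Finset.mem_filter] at hJ ⊢
      exact ⟨hJ.1, hcon J hJ.1 hJ.2⟩
    omega
  obtain ⟨J, hJ, haJ, haJ1⟩ := this
  obtain ⟨k', hk'⟩ := lc_of_mem hN hB hJ
  have e3 := hk'.2.2 a haJ haJ1
  have hkk : k = k' := by omega
  subst hkk
  have : I = J := Finset.Subset.antisymm
    (lc_subset hN hI hk' h le_rfl haJ ha)
    (lc_subset hN (hB.1 J hJ) h hk' le_rfl ha haJ)
  rwa [this]

theorem gs_inj {N : ℕ} [NeZero N] (hN : 3 ≤ N) {B B' : Finset (Finset (ZMod N))}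
    (hB : B ∈ phiSet (cadj N)) (hB' : B' ∈ phiSet (cadj N)) (h : gs B = gs B') : B = B' := by
  ext I
  constructor
  · intro hI
    obtain ⟨k, hk⟩ := lc_of_mem hN hB hI
    rw [h] at hk
    exact mem_of_lc hN hB' (hB.1 I hI) hk
  · intro hI
    obtain ⟨k, hk⟩ := lc_of_mem hN hB' hI
    rw [← h] at hk
    exact mem_of_lc hN hB (hB'.1 I hI) hk

theorem wk_parity {N : ℕ} {g : ZMod N → ℕ} (hg : Wk g) (a : ZMod N) (l : ℕ)
    (h : ∀ j : ℕ, j < l → 0 < g (a + j)) :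
    ∀ j : ℕ, j < l → (g (a + j) + j) % 2 = g a % 2 := by
  intro j
  induction j with
  | zero => intro _; simp
  | succ j ih =>
    intro hj
    have h1 := ih (by omega)
    have h2 := h j (by omega)
    have h3 := hg (a + j)
    rw [show a + (j : ZMod N) + 1 = a + ((j + 1 : ℕ) : ZMod N) by push_cast; ring] at h3
    omega

theorem wk_zero {N : ℕ} [NeZero N] (hodd : Odd N) {g : ZMod N → ℕ} (hg : Wk g) :
    ∃ z, g z = 0 := by
  by_contra hcon
  push Not at hcon
  have := wk_parity hg 0 (N + 1) (fun j _ => Nat.pos_of_ne_zero (hcon _)) N (by omega)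
  rw [ZMod.natCast_self, add_zero] at this
  rw [Nat.odd_iff] at hodd
  omega

theorem exists_lc {N : ℕ} [NeZero N] (hN : 3 ≤ N) (hodd : Odd N) {g : ZMod N → ℕ} (hg : Wk g)
    {s : ZMod N} {k : ℕ} (hk : k < g s) :
    ∃ I, CalI1 (cadj N) I ∧ s ∈ I ∧ LC g k I := by
  classical
  obtain ⟨z, hz⟩ := wk_zero hodd hg
  have exn : ∃ n : ℕ, g (s - n) ≤ k := by
    refine ⟨(s - z).val, ?_⟩
    rw [ZMod.natCast_zmod_val, sub_sub_cancel, hz]; omega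
  have exm : ∃ n : ℕ, g (s + n) ≤ k := by
    refine ⟨(z - s).val, ?_⟩
    rw [cast_val_sub, hz]; omega
  obtain ⟨n, hn, hnmin⟩ : ∃ n : ℕ, g (s - n) ≤ k ∧ ∀ j < n, k < g (s - (j : ℕ)) :=
    ⟨Nat.find exn, Nat.find_spec exn, fun j hj => not_le.mp (Nat.find_min exn hj)⟩
  obtain ⟨m, hm, hmmin⟩ : ∃ n : ℕ, g (s + n) ≤ k ∧ ∀ j < n, k < g (s + (j : ℕ)) :=
    ⟨Nat.find exm, Nat.find_spec exm, fun j hj => not_le.mp (Nat.find_min exm hj)⟩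
  have hn0 : n ≠ 0 := by rintro rfl; simp at hn; omega
  have hm0 : m ≠ 0 := by rintro rfl; simp at hm; omega
  obtain ⟨n, rfl⟩ := Nat.exists_eq_succ_of_ne_zero hn0
  obtain ⟨m, rfl⟩ := Nat.exists_eq_succ_of_ne_zero hm0
  set a : ZMod N := s - n with ha
  set l := n + m + 1 with hl
  have hin : ∀ j : ℕ, j < l → k < g (a + j) := by
    intro j hj
    rcases Nat.lt_or_ge j n with h | h
    · have := hnmin (n - j) (by omega)
      rwa [Nat.cast_sub h.le, show s - ((n : ZMod N) - j) = a + j by rw [ha]; ring] at this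
    · have := hmmin (j - n) (by omega)
      rwa [Nat.cast_sub h, show s + ((j : ZMod N) - n) = a + j by rw [ha]; ring] at this
  have hlN : l < N := by
    by_contra hcon
    have h1 := ZMod.val_lt (z - a)
    have h2 := hin (z - a).val (by omega)
    rw [cast_val_sub, hz] at h2
    omega
  have hina : ∀ t ∈ arc a l, k < g t := by
    intro t ht
    rw [mem_arc] at ht
    have := hin _ ht
    rwa [cast_val_sub] at this
  have hL : g (a - 1) ≤ k := by
    have : a - 1 = s - ((n + 1 : ℕ) : ZMod N) := by rw [ha]; push_cast; ring
    rw [this]; exact hn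
  have hR : g (a + l) ≤ k := by
    have : a + (l : ZMod N) = s + ((m + 1 : ℕ) : ZMod N) := by rw [ha, hl]; push_cast; ring
    rw [this]; exact hm
  have ha0 : k < g a := by have := hin 0 (by omega); simpa using this
  have hga : g a = k + 1 := by
    have := hg (a - 1)
    rw [sub_add_cancel] at this
    omega
  have hgl : g (a + ((n + m : ℕ) : ZMod N)) = k + 1 := by
    have h1 := hin (n + m) (by omega)
    have := hg (a + ((n + m : ℕ) : ZMod N))
    rw [show a + ((n + m : ℕ) : ZMod N) + 1 = a + (l : ZMod N) by rw [hl]; push_cast; ring] at this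
    omega
  have hlo : Odd l := by
    have := wk_parity hg a l (fun j hj => by have := hin j hj; omega) (n + m) (by omega)
    rw [Nat.odd_iff]; omega
  refine ⟨arc a l, calI1_arc hN a hlN hlo, ?_, hina, ?_, ?_⟩
  · rw [mem_arc]
    have : s = a + n := by rw [ha]; ring
    rw [this, val_cast_add a (by omega)]; omega
  · intro t ht ht1
    have h1 := arc_end hN hlN ht ht1
    have h2 : t + 1 = a + l := by
      rw [← h1]; push_cast
      have := cast_val_sub a t
      rw [← add_assoc, this]
    have h3 := hina t ht
    have h4 := hg t
    rw [h2] at h4 ⊢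
    omega
  · intro t ht ht1
    have h1 := arc_start hN hlN ht ht1
    rw [h1]
    have := hg (a - 1)
    rw [sub_add_cancel] at this
    omega

open scoped Classical in
/-- The family reconstructed from a depth function. -/
noncomputable def Bof {N : ℕ} [NeZero N] (g : ZMod N → ℕ) : Finset (Finset (ZMod N)) :=
  Finset.univ.filter (fun I => CalI1 (cadj N) I ∧ ∃ k, LC g k I)

theorem mem_Bof {N : ℕ} [NeZero N] {g : ZMod N → ℕ} {I : Finset (ZMod N)} :
    I ∈ Bof g ↔ CalI1 (cadj N) I ∧ ∃ k, LC g k I := by simp [Bof]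

theorem lc_p0 {N : ℕ} [NeZero N] (hN : 3 ≤ N) {g : ZMod N → ℕ} {k k' : ℕ}
    {I J : Finset (ZMod N)} (hI : CalI1 (cadj N) I) (hJ : CalI1 (cadj N) J)
    (h1 : LC g k I) (h2 : LC g k' J) (hk : k ≤ k') :
    I = J ∨ Spade (cadj N) J I ∨ Prec (cadj N) J I := by
  by_cases hx : ∃ s, s ∈ I ∧ s ∈ J
  · obtain ⟨s, hsI, hsJ⟩ := hx
    rcases Nat.lt_or_ge k k' with h | h
    · right; right; exact lc_prec hN hI hJ h1 h2 h hsI hsJ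
    · left
      exact Finset.Subset.antisymm (lc_subset hN hI h2 h1 h hsJ hsI)
        (lc_subset hN hJ h1 h2 hk hsI hsJ)
  · push Not at hx
    right; left
    rw [spade_iff hN hJ hI]
    intro s hs
    have hsI : s ∉ I := fun h => hx s h hs
    have e := h2.1 s hs
    refine ⟨hsI, fun h => ?_, fun h => ?_⟩
    · have := h1.2.2 _ h (by rwa [add_sub_cancel_right])
      rw [add_sub_cancel_right] at this
      omega
    · have := h1.2.1 _ h (by rwa [sub_add_cancel])
      rw [sub_add_cancel] at this
      omega

theorem spade_symm {N : ℕ} {I J : Finset (ZMod N)} (h : Spade (cadj N) I J) :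
    Spade (cadj N) J I := by
  obtain ⟨h1, h2⟩ := h
  exact ⟨by rwa [Finset.inter_comm], by rwa [Finset.union_comm]⟩

theorem Bof_mem {N : ℕ} [NeZero N] (hN : 3 ≤ N) (hodd : Odd N) {g : ZMod N → ℕ} (hg : Wk g) :
    Bof g ∈ phiSet (cadj N) := by
  classical
  have hp0 : P0 (cadj N) (Bof g) := by
    intro I hI J hJ
    obtain ⟨hI, k, hk⟩ := mem_Bof.mp hI
    obtain ⟨hJ, k', hk'⟩ := mem_Bof.mp hJ
    rcases Nat.le_total k k' with h | h
    · rcases lc_p0 hN hI hJ hk hk' h with h | h | h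
      · exact Or.inl h
      · exact Or.inr (Or.inl (spade_symm h))
      · exact Or.inr (Or.inr (Or.inr h))
    · rcases lc_p0 hN hJ hI hk' hk h with h | h | h
      · exact Or.inl h.symm
      · exact Or.inr (Or.inl h)
      · exact Or.inr (Or.inr (Or.inl h))
  refine ⟨fun I hI => (mem_Bof.mp hI).1, hp0, ?_⟩
  intro I hI
  obtain ⟨hIc, k, hk⟩ := mem_Bof.mp hI
  have hcov : ∀ s ∈ Iev (cadj N) I, ∃ J ∈ Bof g, Prec (cadj N) J I ∧ s ∈ J := by
    intro s hs
    have hsI := hs.1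
    obtain ⟨a, l, hl, hlo, rfl⟩ := arc_of_calI1 hN hIc
    have ho := odd_of_iev hN hl hs
    have hpos := hlo.pos
    have hin : ∀ j : ℕ, j < l → k < g (a + j) := by
      intro j hj
      apply hk.1
      rw [mem_arc, val_cast_add a (by omega)]; exact hj
    have hga : g a = k + 1 := by
      have h0 := hin 0 hpos
      simp only [Nat.cast_zero, add_zero] at h0
      have h1 := hk.2.2 a (by rw [mem_arc]; simpa using hpos) (by
        rw [mem_arc]
        have := sub_pred hN a a
        simp only [sub_self, ZMod.val_zero] at this
        omega)
      have := hg (a - 1)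
      rw [sub_add_cancel] at this
      omega
    have hpar := wk_parity hg a l (fun j hj => by have := hin j hj; omega) (s - a).val
      (mem_arc.mp hsI)
    rw [cast_val_sub] at hpar
    have h1 := hk.1 s hsI
    rw [Nat.odd_iff] at ho
    have h2 : k + 1 < g s := by omega
    obtain ⟨J, hJ, hsJ, hJl⟩ := exists_lc hN hodd hg h2
    exact ⟨J, mem_Bof.mpr ⟨hJ, _, hJl⟩, lc_prec hN hIc hJ hk hJl (by omega) hsI hsJ, hsJ⟩
  set T := (Bof g).filter (fun J => Prec (cadj N) J I) with hT
  set M := T.filter (fun J => Maximal (· ∈ T) J) with hM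
  refine ⟨M.card, fun j => (M.equivFin.symm j : Finset (ZMod N)), ?_, ?_, ?_⟩
  · intro j
    have h1 := (M.equivFin.symm j).2
    have h2 := (Finset.mem_filter.mp h1).1
    exact Finset.mem_filter.mp h2
  · intro i j hij
    set X := M.equivFin.symm i with hX
    set Y := M.equivFin.symm j with hY
    have hne : (X : Finset (ZMod N)) ≠ Y := by
      intro h
      exact hij (M.equivFin.symm.injective (Subtype.ext h))
    obtain ⟨hXT, hXm⟩ := Finset.mem_filter.mp X.2
    obtain ⟨hYT, hYm⟩ := Finset.mem_filter.mp Y.2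
    rcases hp0 _ (Finset.mem_filter.mp hXT).1 _ (Finset.mem_filter.mp hYT).1 with h | h | h | h
    · exact absurd h hne
    · exact Finset.disjoint_iff_inter_eq_empty.mpr h.1
    · exact absurd (hXm.eq_of_le hYT h.1.1) hne
    · exact absurd (hYm.eq_of_le hXT h.1.1) hne.symm
  · intro s hs
    obtain ⟨J, hJ, hJI, hsJ⟩ := hcov s hs
    have hJT : J ∈ T := Finset.mem_filter.mpr ⟨hJ, hJI⟩
    obtain ⟨K, hJK, hK⟩ := T.exists_le_maximal hJT
    have hKM : K ∈ M := Finset.mem_filter.mpr ⟨hK.prop, hK⟩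
    rw [Set.mem_iUnion]
    refine ⟨M.equivFin ⟨K, hKM⟩, ?_⟩
    simp only [Equiv.symm_apply_apply]
    exact hJK hsJ

theorem gs_Bof {N : ℕ} [NeZero N] (hN : 3 ≤ N) (hodd : Odd N) {g : ZMod N → ℕ} (hg : Wk g) :
    gs (Bof g) = g := by
  have hphi := Bof_mem hN hodd hg
  have hG := gs_wk hN hphi
  obtain ⟨z, hz⟩ := wk_zero hodd hg
  have hzero : ∀ t, g t = 0 → gs (Bof g) t = 0 := by
    intro t ht
    rw [gs, Finset.card_eq_zero, Finset.filter_eq_empty_iff]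
    intro I hI htI
    obtain ⟨-, k, hk⟩ := mem_Bof.mp hI
    have := hk.1 t htI
    omega
  have main : ∀ n : ℕ, gs (Bof g) (z + n) = g (z + n) := by
    intro n
    induction n with
    | zero => simp only [Nat.cast_zero, add_zero]; rw [hz, hzero z hz]
    | succ n ih =>
      rw [show z + ((n + 1 : ℕ) : ZMod N) = z + n + 1 by push_cast; ring]
      set s := z + (n : ZMod N) with hs
      rcases hg s with h | h | h
      · obtain ⟨I, hI, hsI, hl⟩ := exists_lc hN hodd hg (s := s + 1) (k := g s) (by omega)
        have hsn : s ∉ I := fun h' => by have := hl.1 s h'; omega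
        obtain ⟨k', hk'⟩ := lc_of_mem hN hphi (mem_Bof.mpr ⟨hI, _, hl⟩)
        have e1 := hk'.1 _ hsI
        have e2 := hk'.2.2 _ hsI (by rwa [add_sub_cancel_right])
        rw [add_sub_cancel_right] at e2
        have := hG s
        omega
      · rcases hG s with h' | h' | h'
        · exfalso
          have : ∃ J ∈ Bof g, s + 1 ∈ J ∧ s ∉ J := by
            by_contra hcon
            push Not at hcon
            have : gs (Bof g) (s + 1) ≤ gs (Bof g) s := by
              apply Finset.card_le_card
              intro J hJ
              simp only [Finset.mem_filter] at hJ ⊢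
              exact ⟨hJ.1, hcon J hJ.1 hJ.2⟩
            omega
          obtain ⟨J, hJ, h1, h2⟩ := this
          obtain ⟨-, k, hk⟩ := mem_Bof.mp hJ
          have e1 := hk.1 _ h1
          have e2 := hk.2.2 _ h1 (by rwa [add_sub_cancel_right])
          rw [add_sub_cancel_right] at e2
          omega
        · omega
        · omega
      · rw [h.2, hzero _ h.2]
  funext s
  have := main (s - z).val
  rwa [cast_val_sub] at this

/-- The pattern `0,1,1,0` of period four. -/
def ci (x : ℤ) : ZMod 2 := if x % 4 = 1 ∨ x % 4 = 2 then 1 else 0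

/-- Folding of the integers onto the naturals. -/
def fd (x : ℤ) : ℕ := if 0 ≤ x then x.toNat else (-1 - x).toNat

/-- The step of the lifted walk. -/
def stp (x : ℤ) (a b : ZMod 2) : ℤ := if (x % 2 = 0 ↔ a ≠ b) then x + 1 else x - 1

/-- The lifted walk. -/
def lf {N : ℕ} (v : ZMod N → ZMod 2) (x0 : ℤ) : ℕ → ℤ
  | 0 => x0
  | n + 1 => stp (lf v x0 n) (v (n : ZMod N)) (v ((n + 1 : ℕ) : ZMod N))

/-- The quadratic form. -/
def Qf {N : ℕ} [NeZero N] (v : ZMod N → ZMod 2) : ZMod 2 := ∑ s, v s * v (s + 1)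

theorem ci_eq_one (x : ℤ) : ci x = 1 ↔ (x % 4 = 1 ∨ x % 4 = 2) := by
  unfold ci; split_ifs with h <;> simp [h]

theorem zmod2_eq_iff (a b : ZMod 2) : a = b ↔ (a = 1 ↔ b = 1) := by
  revert a b; decide

theorem ci_nat (n : ℕ) : ((n * (n + 1) / 2 : ℕ) : ZMod 2) = ci n := by
  have key : ((n * (n + 1) / 2 : ℕ) : ZMod 2) = 1 ↔ (n * (n + 1) / 2) % 2 = 1 := by
    rw [← Nat.odd_iff]; exact ZMod.natCast_eq_one_iff_odd
  rw [zmod2_eq_iff, key, ci_eq_one]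
  obtain ⟨q, r, hr, rfl⟩ : ∃ q r, r < 4 ∧ n = 4 * q + r :=
    ⟨n / 4, n % 4, Nat.mod_lt _ (by norm_num), by omega⟩
  have : r = 0 ∨ r = 1 ∨ r = 2 ∨ r = 3 := by omega
  rcases this with rfl | rfl | rfl | rfl
  · have e : (4 * q + 0) * (4 * q + 0 + 1) = 2 * (2 * (q * (4 * q + 1))) := by ring
    rw [e, Nat.mul_div_cancel_left _ (by norm_num)]
    omega
  · have e : (4 * q + 1) * (4 * q + 1 + 1) = 2 * (2 * (4 * q * q + 3 * q) + 1) := by ring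
    rw [e, Nat.mul_div_cancel_left _ (by norm_num)]
    omega
  · have e : (4 * q + 2) * (4 * q + 2 + 1) = 2 * (2 * (4 * q * q + 5 * q + 1) + 1) := by ring
    rw [e, Nat.mul_div_cancel_left _ (by norm_num)]
    omega
  · have e : (4 * q + 3) * (4 * q + 3 + 1) = 2 * (2 * ((4 * q + 3) * (q + 1))) := by ring
    rw [e, Nat.mul_div_cancel_left _ (by norm_num)]
    omega

theorem ci_half (n : ℕ) : (((n + 1) / 2 : ℕ) : ZMod 2) = ci n := by
  have key : (((n + 1) / 2 : ℕ) : ZMod 2) = 1 ↔ ((n + 1) / 2) % 2 = 1 := by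
    rw [← Nat.odd_iff]; exact ZMod.natCast_eq_one_iff_odd
  rw [zmod2_eq_iff, key, ci_eq_one]
  omega

theorem ci_fd (x : ℤ) : ci (fd x) = ci x := by
  rw [zmod2_eq_iff, ci_eq_one, ci_eq_one]
  unfold fd
  split_ifs with h <;> omega

theorem fd_stp (x : ℤ) (m m' : ℕ) (h : fd x = m)
    (hw : m' = m + 1 ∨ m = m' + 1 ∨ (m = 0 ∧ m' = 0)) : fd (stp x (ci m) (ci m')) = m' := by
  have e : (ci m ≠ ci m') ↔ ¬ (((m : ℤ) % 4 = 1 ∨ (m : ℤ) % 4 = 2) ↔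
      ((m' : ℤ) % 4 = 1 ∨ (m' : ℤ) % 4 = 2)) := by
    rw [ne_eq, zmod2_eq_iff, ci_eq_one, ci_eq_one]
  unfold stp
  simp only [e]
  unfold fd at *
  split_ifs at * <;> omega

theorem ci_stp (x : ℤ) (a b : ZMod 2) (h : ci x = a) : ci (stp x a b) = b := by
  subst h
  have e : (ci x ≠ b) ↔ ¬ ((x % 4 = 1 ∨ x % 4 = 2) ↔ b = 1) := by
    rw [ne_eq, zmod2_eq_iff, ci_eq_one]
  rw [zmod2_eq_iff, ci_eq_one]
  unfold stp
  simp only [e]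
  by_cases hb : b = 1 <;> simp only [hb, iff_true, iff_false] <;> split_ifs <;> omega

theorem H_stp (x : ℤ) (a b : ZMod 2) (h : ci x = a) :
    (((stp x a b + 2) / 4 : ℤ) : ZMod 2) = (((x + 2) / 4 : ℤ) : ZMod 2) + a * b := by
  have h2 := ci_stp x a b h
  have hs : stp x a b = x + 1 ∨ stp x a b = x - 1 := by unfold stp; split_ifs <;> simp
  generalize stp x a b = y at *
  subst h h2
  have key : ∀ z : ℤ, ((z : ZMod 2) = 1) ↔ z % 2 = 1 := by
    intro z; rw [← Int.odd_iff]; exact ZMod.intCast_eq_one_iff_odd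
  have k2 : ∀ p q r : ZMod 2, (p = q + r) ↔ ((p = 1 ↔ q = 1) ↔ ¬ (r = 1)) := by decide
  have k3 : ∀ p q : ZMod 2, (p * q = 1) ↔ (p = 1 ∧ q = 1) := by decide
  rw [k2, k3, key, key, ci_eq_one, ci_eq_one]
  omega

theorem lf_shift {N : ℕ} (v : ZMod N → ZMod 2) (x0 k : ℤ) (n : ℕ) :
    lf v (x0 + 4 * k) n = lf v x0 n + 4 * k := by
  induction n with
  | zero => rfl
  | succ n ih =>
    simp only [lf, ih, stp]
    have : (lf v x0 n + 4 * k) % 2 = lf v x0 n % 2 := by omega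
    rw [this]
    split_ifs <;> ring

theorem lf_parity {N : ℕ} (v : ZMod N → ZMod 2) (x0 : ℤ) (n : ℕ) :
    (lf v x0 n + n) % 2 = x0 % 2 := by
  induction n with
  | zero => simp [lf]
  | succ n ih =>
    simp only [lf, stp]
    split_ifs <;> push_cast <;> omega

theorem lf_ci {N : ℕ} (v : ZMod N → ZMod 2) (x0 : ℤ) (h : ci x0 = v 0) (n : ℕ) :
    ci (lf v x0 n) = v (n : ZMod N) := by
  induction n with
  | zero => simpa [lf] using h
  | succ n ih => exact ci_stp _ _ _ ih

theorem lf_H {N : ℕ} (v : ZMod N → ZMod 2) (x0 : ℤ) (h : ci x0 = v 0) (n : ℕ) :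
    (((lf v x0 n + 2) / 4 : ℤ) : ZMod 2) = (((x0 + 2) / 4 : ℤ) : ZMod 2) +
      ∑ i ∈ Finset.range n, v (i : ZMod N) * v ((i + 1 : ℕ) : ZMod N) := by
  induction n with
  | zero => simp [lf]
  | succ n ih =>
    rw [Finset.sum_range_succ, ← add_assoc, ← ih]
    exact H_stp _ _ _ (lf_ci v x0 h n)

theorem lf_fd {N : ℕ} {g : ZMod N → ℕ} (hg : Wk g) (x0 : ℤ) (h : fd x0 = g 0) (n : ℕ) :
    fd (lf (fun s => ci (g s)) x0 n) = g n := by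
  induction n with
  | zero => simpa [lf] using h
  | succ n ih =>
    have := hg n
    rw [show (n : ZMod N) + 1 = ((n + 1 : ℕ) : ZMod N) by push_cast; ring] at this
    exact fd_stp _ _ _ ih this

theorem sum_range_cast {N : ℕ} [NeZero N] {M : Type} [AddCommMonoid M] (f : ZMod N → M) :
    ∑ i ∈ Finset.range N, f (i : ZMod N) = ∑ s, f s := by
  have e : (Finset.univ : Finset (ZMod N)) = arc 0 N := by
    ext s; simp [mem_arc, ZMod.val_lt]
  rw [e, arc_eq_image 0 le_rfl, Finset.sum_image]
  · simp
  · intro i hi j hj h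
    simp only [Finset.coe_range, Set.mem_Iio] at hi hj
    have h1 := val_cast_add (0 : ZMod N) hi
    have h2 := val_cast_add (0 : ZMod N) hj
    simp only at h
    rw [← h1, ← h2, h]

theorem wk_inj {N : ℕ} [NeZero N] (hodd : Odd N) {g h : ZMod N → ℕ} (hg : Wk g) (hh : Wk h)
    (e : ∀ s, ci (g s) = ci (h s)) : g = h := by
  have e' : (fun s => ci (g s)) = (fun s => ci (h s)) := funext e
  have hx : fd (g 0 : ℤ) = g 0 := by unfold fd; split_ifs <;> omega
  obtain ⟨k, hy⟩ : ∃ k : ℤ, fd ((g 0 : ℤ) + 4 * k) = h 0 := by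
    have h0 := e 0
    rw [zmod2_eq_iff, ci_eq_one, ci_eq_one] at h0
    by_cases hp : (g 0 : ℤ) % 4 = (h 0 : ℤ) % 4
    · refine ⟨((h 0 : ℤ) - g 0) / 4, ?_⟩
      have : (g 0 : ℤ) + 4 * (((h 0 : ℤ) - g 0) / 4) = h 0 := by omega
      rw [this]; unfold fd; split_ifs <;> omega
    · refine ⟨(-1 - (h 0 : ℤ) - g 0) / 4, ?_⟩
      have : (g 0 : ℤ) + 4 * ((-1 - (h 0 : ℤ) - g 0) / 4) = -1 - h 0 := by omega
      rw [this]; unfold fd; split_ifs <;> omega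
  have a1 := lf_fd hg _ hx
  have a2 := lf_fd hh _ hy
  rw [← e'] at a2
  have p1 := lf_parity (fun s => ci (g s)) (g 0 : ℤ) N
  have b1 := a1 N
  have b2 := a2 N
  have hsh := lf_shift (fun s => ci (g s)) (g 0 : ℤ) k
  rw [hsh N] at b2
  rw [ZMod.natCast_self] at b1 b2
  obtain ⟨q, hq⟩ := hodd
  have hk : k = 0 := by
    generalize lf (fun s => ci (g s)) (g 0 : ℤ) N = X at *
    rw [← hy] at b2
    unfold fd at b1 b2
    split_ifs at b1 b2 <;> omega
  funext s
  have c1 := a1 s.val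
  have c2 := a2 s.val
  rw [hsh, hk, mul_zero, add_zero, c1] at c2
  rwa [ZMod.natCast_zmod_val] at c2

theorem wk_surj {N : ℕ} [NeZero N] (hN : 3 ≤ N) (hodd : Odd N) (v : ZMod N → ZMod 2)
    (hv : Qf v = 0) : ∃ g : ZMod N → ℕ, Wk g ∧ ∀ s, ci (g s) = v s := by
  obtain ⟨x0, hx0⟩ : ∃ x0 : ℤ, ci x0 = v 0 := by
    by_cases h : v 0 = 1
    · exact ⟨1, by rw [h, ci_eq_one]; omega⟩
    · exact ⟨0, by rw [zmod2_eq_iff, ci_eq_one]; simp [h]⟩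
  have h1 := lf_ci v x0 hx0 N
  have h2 := lf_parity v x0 N
  have h3 := lf_H v x0 hx0 N
  have h4 : ∑ i ∈ Finset.range N, v (i : ZMod N) * v ((i + 1 : ℕ) : ZMod N) = 0 := by
    rw [← hv, Qf, ← sum_range_cast (fun s => v s * v (s + 1))]
    apply Finset.sum_congr rfl
    intro i _; push_cast; rfl
  rw [h4, add_zero, zmod2_eq_iff] at h3
  have key : ∀ z : ℤ, ((z : ZMod 2) = 1) ↔ z % 2 = 1 := by
    intro z; rw [← Int.odd_iff]; exact ZMod.intCast_eq_one_iff_odd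
  rw [key, key] at h3
  rw [ZMod.natCast_self, ← hx0, zmod2_eq_iff, ci_eq_one, ci_eq_one] at h1
  obtain ⟨q, hq⟩ := hodd
  obtain ⟨m, hm⟩ : ∃ m : ℤ, lf v x0 N + x0 = -1 + 8 * m :=
    ⟨(lf v x0 N + x0 + 1) / 8, by generalize lf v x0 N = X at *; omega⟩
  have hsh := lf_shift v x0 (-m)
  set y0 := x0 + 4 * (-m) with hy0
  have hy : ci y0 = v 0 := by
    rw [← hx0, zmod2_eq_iff, ci_eq_one, ci_eq_one]; omega
  have hend : lf v y0 N = -1 - y0 := by rw [hsh]; omega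
  refine ⟨fun s => fd (lf v y0 s.val), ?_, ?_⟩
  · intro s
    simp only
    have hst : lf v y0 (s.val + 1) = lf v y0 s.val + 1 ∨
        lf v y0 (s.val + 1) = lf v y0 s.val - 1 := by
      simp only [lf, stp]; split_ifs <;> simp
    have hf : fd (lf v y0 (s + 1).val) = fd (lf v y0 (s.val + 1)) := by
      rcases val_succ hN s with h | h
      · rw [h.2]
      · rw [h.2, h.1, hend]
        simp only [lf]
        unfold fd; split_ifs <;> omega
    rw [hf]
    generalize lf v y0 (s.val + 1) = Y at *
    generalize lf v y0 s.val = X at *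
    unfold fd
    split_ifs <;> omega
  · intro s
    simp only
    rw [ci_fd, lf_ci v y0 hy, ZMod.natCast_zmod_val]

theorem eSum_apply {N : ℕ} [NeZero N] (I : Finset (ZMod N)) (s : ZMod N) :
    eSum (eVec N) I s = if s ∈ I then 1 else 0 := by
  simp only [eSum, eVec, Finset.sum_apply, Pi.single_apply]
  rw [Finset.sum_ite_eq]

theorem epsB_apply {N : ℕ} [NeZero N] (B : Finset (Finset (ZMod N))) (s : ZMod N) :
    epsB (eVec N) B s = ci (gs B s) := by
  rw [← ci_nat]
  simp only [epsB, eVec, Finset.sum_apply, Pi.smul_apply, Pi.single_apply, smul_eq_mul,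
    mul_ite, mul_one, mul_zero]
  rw [Finset.sum_ite_eq]; simp

/-- The number of members of `B` containing `I`. -/
def lay {N : ℕ} (B : Finset (Finset (ZMod N))) (I : Finset (ZMod N)) : ℕ :=
  (B.filter (fun J => I ⊆ J)).card

theorem card_odd_Icc (n : ℕ) : ((Finset.Icc 1 n).filter Odd).card = (n + 1) / 2 := by
  induction n with
  | zero => simp
  | succ n ih =>
    rw [← Finset.insert_Icc_right_eq_Icc_add_one (by omega), Finset.filter_insert]
    split_ifs with h
    · rw [Finset.card_insert_of_notMem (by simp), ih]
      rw [Nat.odd_iff] at h; omega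
    · rw [ih]; rw [Nat.odd_iff] at h; omega

theorem eps_mem {N : ℕ} [NeZero N] (hN : 3 ≤ N) {B : Finset (Finset (ZMod N))}
    (hB : B ∈ phiSet (cadj N)) : epsB (eVec N) B ∈ LB (eVec N) B := by
  classical
  have e : epsB (eVec N) B = ∑ I ∈ B.filter (fun I => Odd (lay B I)), eSum (eVec N) I := by
    funext s
    rw [epsB_apply, Finset.sum_apply]
    simp only [eSum_apply]
    rw [← Finset.sum_filter, Finset.sum_const, nsmul_one, Finset.filter_filter]
    set C := B.filter (fun I => s ∈ I) with hC
    have hcomp : ∀ I ∈ C, ∀ J ∈ C, I ≠ J → I ⊂ J ∨ J ⊂ I := by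
      intro I hI J hJ hne
      simp only [hC, Finset.mem_filter] at hI hJ
      rcases phi_p0 hN hB hI.1 hJ.1 with h | h | h | h
      · exact absurd h hne
      · exact absurd hJ.2 (h s hI.2).1
      · exact Or.inl (h.1.ssubset_of_ne hne)
      · exact Or.inr (h.1.ssubset_of_ne hne.symm)
    have hmono : ∀ I ∈ C, ∀ J ∈ C, I ⊂ J → lay B J < lay B I := by
      intro I hI J hJ hIJ
      simp only [hC, Finset.mem_filter] at hI hJ
      apply Finset.card_lt_card
      rw [Finset.ssubset_iff_of_subset]
      · exact ⟨I, by simp [hI.1], by simp only [Finset.mem_filter, not_and]; exact fun _ => hIJ.2⟩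
      · intro K hK
        simp only [Finset.mem_filter] at hK ⊢
        exact ⟨hK.1, hIJ.1.trans hK.2⟩
    have hinj : Set.InjOn (lay B) C := by
      intro I hI J hJ h
      by_contra hne
      rcases hcomp I hI J hJ hne with h' | h'
      · have := hmono I hI J hJ h'; omega
      · have := hmono J hJ I hI h'; omega
    have himg : C.image (lay B) = Finset.Icc 1 (gs B s) := by
      apply Finset.eq_of_subset_of_card_le
      · intro n hn
        obtain ⟨I, hI, rfl⟩ := Finset.mem_image.mp hn
        simp only [hC, Finset.mem_filter] at hI
        rw [Finset.mem_Icc]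
        constructor
        · exact Finset.card_pos.mpr ⟨I, by simp [hI.1]⟩
        · apply Finset.card_le_card
          intro J hJ
          simp only [Finset.mem_filter] at hJ ⊢
          exact ⟨hJ.1, hJ.2 hI.2⟩
      · rw [Finset.card_image_of_injOn hinj, Nat.card_Icc]
        simp [gs, hC]
    have hcard : (B.filter (fun I => Odd (lay B I) ∧ s ∈ I)).card = (gs B s + 1) / 2 := by
      rw [← card_odd_Icc, ← himg, Finset.filter_image, Finset.card_image_of_injOn]
      · congr 1; ext I; simp only [hC, Finset.mem_filter]; tauto
      · exact hinj.mono (by intro I hI; exact (Finset.mem_filter.mp hI).1)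
    rw [hcard, ci_half]
  rw [e]
  apply Submodule.sum_mem
  intro I hI
  exact Submodule.subset_span ⟨I, (Finset.mem_filter.mp hI).1, rfl⟩

/-- The bilinear form. -/
def bf {N : ℕ} [NeZero N] (v w : ZMod N → ZMod 2) : ZMod 2 :=
  ∑ s, v s * (w (s + 1) + w (s - 1))

theorem sum_shift {N : ℕ} [NeZero N] (f : ZMod N → ZMod 2) : ∑ s, f (s - 1) = ∑ s, f s :=
  Equiv.sum_comp (Equiv.subRight (1 : ZMod N)) f

theorem Qf_add {N : ℕ} [NeZero N] (v w : ZMod N → ZMod 2) :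
    Qf (v + w) = Qf v + Qf w + bf v w := by
  have h := sum_shift (fun s => w s * v (s + 1))
  simp only [sub_add_cancel] at h
  have h2 : bf v w = ∑ s, v s * w (s + 1) + ∑ s, w s * v (s + 1) := by
    rw [← h, bf, ← Finset.sum_add_distrib]
    apply Finset.sum_congr rfl; intro s _; ring
  rw [h2]
  simp only [Qf, Pi.add_apply, ← Finset.sum_add_distrib]
  apply Finset.sum_congr rfl; intro s _; ring

theorem bf_add_left {N : ℕ} [NeZero N] (v v' w : ZMod N → ZMod 2) :
    bf (v + v') w = bf v w + bf v' w := by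
  simp only [bf, Pi.add_apply, ← Finset.sum_add_distrib]
  apply Finset.sum_congr rfl; intro s _; ring

theorem bf_add_right {N : ℕ} [NeZero N] (v w w' : ZMod N → ZMod 2) :
    bf v (w + w') = bf v w + bf v w' := by
  simp only [bf, Pi.add_apply, ← Finset.sum_add_distrib]
  apply Finset.sum_congr rfl; intro s _; ring

theorem bf_smul_left {N : ℕ} [NeZero N] (c : ZMod 2) (v w : ZMod N → ZMod 2) :
    bf (c • v) w = c * bf v w := by
  simp only [bf, Pi.smul_apply, smul_eq_mul, Finset.mul_sum]
  apply Finset.sum_congr rfl; intro s _; ring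

theorem bf_smul_right {N : ℕ} [NeZero N] (c : ZMod 2) (v w : ZMod N → ZMod 2) :
    bf v (c • w) = c * bf v w := by
  simp only [bf, Pi.smul_apply, smul_eq_mul, Finset.mul_sum]
  apply Finset.sum_congr rfl; intro s _; ring

theorem Qf_smul {N : ℕ} [NeZero N] (c : ZMod 2) (v : ZMod N → ZMod 2) :
    Qf (c • v) = c * c * Qf v := by
  simp only [Qf, Pi.smul_apply, smul_eq_mul, Finset.mul_sum]
  apply Finset.sum_congr rfl; intro s _; ring

theorem bf_comm {N : ℕ} [NeZero N] (v w : ZMod N → ZMod 2) : bf v w = bf w v := by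
  have h1 := Qf_add v w
  have h2 := Qf_add w v
  rw [add_comm w v, h1, add_comm (Qf w) (Qf v)] at h2
  exact add_left_cancel h2

theorem bf_eSum {N : ℕ} [NeZero N] (I J : Finset (ZMod N))
    (h : (∀ s ∈ I, s ∉ J ∧ s + 1 ∉ J ∧ s - 1 ∉ J) ∨
      (I ⊆ J ∧ ∀ s ∈ I, s + 1 ∈ J ∧ s - 1 ∈ J)) :
    bf (eSum (eVec N) I) (eSum (eVec N) J) = 0 := by
  apply Finset.sum_eq_zero
  intro s _
  simp only [eSum_apply]
  by_cases hs : s ∈ I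
  · rcases h with h | h
    · have := h s hs
      simp [this.2.1, this.2.2]
    · have := h.2 s hs
      simp only [hs, this.1, this.2, if_true]; decide
  · simp [hs]

theorem Qf_eSum {N : ℕ} [NeZero N] (I : Finset (ZMod N)) :
    Qf (eSum (eVec N) I) = ((I.filter (fun s => s + 1 ∈ I)).card : ZMod 2) := by
  simp only [Qf, eSum_apply]
  rw [Finset.card_filter]
  push_cast
  rw [← Finset.sum_filter_add_sum_filter_not Finset.univ (fun s => s ∈ I)]
  rw [Finset.sum_eq_zero (s := Finset.univ.filter (fun s => s ∉ I)), add_zero]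
  · have : (Finset.univ.filter (fun s => s ∈ I)) = I := by ext; simp
    rw [this]
    apply Finset.sum_congr rfl
    intro s hs; simp [hs]
  · intro s hs
    simp only [Finset.mem_filter] at hs
    simp [hs.2]

theorem Qf_eSum_cal {N : ℕ} [NeZero N] (hN : 3 ≤ N) {I : Finset (ZMod N)}
    (hI : CalI1 (cadj N) I) : Qf (eSum (eVec N) I) = 0 := by
  rw [Qf_eSum]
  obtain ⟨a, l, hl, hlo, rfl⟩ := arc_of_calI1 hN hI
  have : (arc a l).filter (fun s => s + 1 ∈ arc a l) = arc a (l - 1) := by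
    ext s
    simp only [Finset.mem_filter, mem_arc]
    have := sub_succ hN s a
    omega
  rw [this, card_arc a (by omega), ZMod.natCast_eq_zero_iff_even]
  rw [Nat.odd_iff] at hlo
  rw [Nat.even_iff]; omega

theorem Qf_of_mem {N : ℕ} [NeZero N] (hN : 3 ≤ N) {B : Finset (Finset (ZMod N))}
    (hB : B ∈ phiSet (cadj N)) {v : Vc N} (hv : v ∈ LB (eVec N) B) : Qf v = 0 := by
  have hgen : ∀ I ∈ B, ∀ J ∈ B, bf (eSum (eVec N) I) (eSum (eVec N) J) = 0 := by
    intro I hI J hJ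
    rcases phi_p0 hN hB hI hJ with h | h | h | h
    · subst h
      have h1 := Qf_add (eSum (eVec N) I) (eSum (eVec N) I)
      have h2 : eSum (eVec N) I + eSum (eVec N) I = 0 := by
        funext s
        have : ∀ x : ZMod 2, x + x = 0 := by decide
        exact this _
      rw [h2, Qf_eSum_cal hN (hB.1 I hI)] at h1
      simpa [Qf] using h1.symm
    · exact bf_eSum I J (Or.inl h)
    · exact bf_eSum I J (Or.inr h)
    · rw [bf_comm]; exact bf_eSum J I (Or.inr h)
  have h1 : ∀ w ∈ LB (eVec N) B, ∀ J ∈ B, bf w (eSum (eVec N) J) = 0 := by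
    intro w hw J hJ
    induction hw using Submodule.span_induction with
    | mem x hx => obtain ⟨I, hI, rfl⟩ := hx; exact hgen I hI J hJ
    | zero => simp [bf]
    | add x y _ _ hx hy => rw [bf_add_left, hx, hy, add_zero]
    | smul c x _ hx => rw [bf_smul_left, hx, mul_zero]
  have h2 : ∀ w ∈ LB (eVec N) B, ∀ u ∈ LB (eVec N) B, bf w u = 0 := by
    intro w hw u hu
    induction hu using Submodule.span_induction with
    | mem x hx => obtain ⟨I, hI, rfl⟩ := hx; exact h1 w hw I hI
    | zero => simp [bf]
    | add x y _ _ hx hy => rw [bf_add_right, hx, hy, add_zero]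
    | smul c x _ hx => rw [bf_smul_right, hx, mul_zero]
  unfold LB at hv
  induction hv using Submodule.span_induction with
  | mem x hx => obtain ⟨I, hI, rfl⟩ := hx; exact Qf_eSum_cal hN (hB.1 I hI)
  | zero => simp [Qf]
  | add x y hx' hy' hx hy => rw [Qf_add, hx, hy, h2 x hx' y hy']; simp
  | smul c x _ hx => rw [Qf_smul, hx, mul_zero]

theorem mem_compOf {N : ℕ} {I : Finset (ZMod N)} {s t : ZMod N} :
    t ∈ compOf (cadj N) I s ↔ t ∈ I ∧
      Relation.ReflTransGen (fun a b => a ∈ I ∧ b ∈ I ∧ cadj N a b) s t := by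
  simp [compOf]

theorem conn_symm {N : ℕ} {I : Finset (ZMod N)} {s t : ZMod N}
    (h : Relation.ReflTransGen (fun a b => a ∈ I ∧ b ∈ I ∧ cadj N a b) s t) :
    Relation.ReflTransGen (fun a b => a ∈ I ∧ b ∈ I ∧ cadj N a b) t s := by
  induction h with
  | refl => exact Relation.ReflTransGen.refl
  | tail _ h ih => exact Relation.ReflTransGen.head ⟨h.2.1, h.1, h.2.2.symm⟩ ih

theorem compOf_eq_iff {N : ℕ} {I : Finset (ZMod N)} {s t : ZMod N} (hs : s ∈ I) :
    compOf (cadj N) I s = compOf (cadj N) I t ↔ s ∈ compOf (cadj N) I t := by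
  constructor
  · intro h
    rw [← h, mem_compOf]
    exact ⟨hs, Relation.ReflTransGen.refl⟩
  · intro h
    have h := (mem_compOf.mp h).2
    ext x
    simp only [mem_compOf]
    exact ⟨fun hx => ⟨hx.1, h.trans hx.2⟩, fun hx => ⟨hx.1, (conn_symm h).trans hx.2⟩⟩

theorem one_end {N : ℕ} [NeZero N] (hN : 3 ≤ N) {I : Finset (ZMod N)} (hI : I ≠ Finset.univ)
    {t : ZMod N} (ht : t ∈ I) :
    ((compOf (cadj N) I t).filter (fun s => ¬ (s + 1 ∈ I))).card = 1 := by
  rw [Finset.card_eq_one]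
  have hex : ∃ e ∈ compOf (cadj N) I t, e + 1 ∉ I := by
    by_contra hcon
    push Not at hcon
    apply hI
    have hall : ∀ n : ℕ, t + n ∈ compOf (cadj N) I t := by
      intro n
      induction n with
      | zero => simp only [Nat.cast_zero, add_zero]; exact mem_compOf.mpr ⟨ht, .refl⟩
      | succ n ih =>
        have h1 := hcon _ ih
        rw [show t + ((n + 1 : ℕ) : ZMod N) = t + n + 1 by push_cast; ring]
        have h2 := mem_compOf.mp ih
        exact mem_compOf.mpr ⟨h1, h2.2.tail ⟨h2.1, h1, Or.inl rfl⟩⟩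
    ext s
    simp only [Finset.mem_univ, iff_true]
    have := hall (s - t).val
    rw [cast_val_sub] at this
    exact (mem_compOf.mp this).1
  obtain ⟨e, he, he1⟩ := hex
  refine ⟨e, ?_⟩
  have heI := (mem_compOf.mp he).1
  have inv : ∀ x, Relation.ReflTransGen (fun a b => a ∈ I ∧ b ∈ I ∧ cadj N a b) e x →
      ∀ j : ℕ, j ≤ (e - x).val → x + j ∈ I := by
    intro x hx
    induction hx with
    | refl =>
      intro j hj
      have : j = 0 := by simpa using hj
      subst this; simpa using heI
    | @tail x y _ hxy ih =>
      obtain ⟨hx, hy, hxy⟩ := hxy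
      intro j hj
      rcases hxy with rfl | rfl
      · have h1 := sub_change e x (x + 1)
        have h2 := sub_succ hN x x
        rw [sub_self, ZMod.val_zero] at h2
        have hne : (e - x).val ≠ 0 := by
          intro h0
          rw [ZMod.val_eq_zero, sub_eq_zero] at h0
          subst h0; exact he1 hy
        have := ih (j + 1) (by omega)
        rwa [show x + ((j + 1 : ℕ) : ZMod N) = x + 1 + j by push_cast; ring] at this
      · have h1 := sub_change e y (y + 1)
        have h2 := sub_succ hN y y
        rw [sub_self, ZMod.val_zero] at h2
        rcases Nat.eq_zero_or_pos j with rfl | hj0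
        · simpa using hy
        · have := ih (j - 1) (by omega)
          rwa [Nat.cast_sub (by omega), show y + 1 + ((j : ZMod N) - (1 : ℕ)) = y + j by
            push_cast; ring] at this
  ext x
  rw [Finset.mem_filter, Finset.mem_singleton]
  constructor
  · rintro ⟨hx, hx1⟩
    have h1 := inv x ((conn_symm (mem_compOf.mp he).2).trans (mem_compOf.mp hx).2)
    by_contra hne
    have h0 : (e - x).val ≠ 0 := by
      intro h0
      rw [ZMod.val_eq_zero, sub_eq_zero] at h0
      exact hne h0.symm
    have := h1 1 (by omega)
    rw [Nat.cast_one] at this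
    exact hx1 this
  · rintro rfl; exact ⟨he, he1⟩

theorem c0card_Qf {N : ℕ} [NeZero N] (hN : 3 ≤ N) {I : Finset (ZMod N)}
    (hI : I ≠ Finset.univ) :
    (c0card (cadj N) I : ZMod 2) = Qf (eSum (eVec N) I) := by
  classical
  rw [Qf_eSum]
  have h1 : (I.filter (fun s => s + 1 ∈ I)).card = ∑ C ∈ comps (cadj N) I,
      ((I.filter (fun s => s + 1 ∈ I)).filter (fun s => compOf (cadj N) I s = C)).card := by
    apply Finset.card_eq_sum_card_fiberwise
    intro s hs
    exact Finset.mem_image_of_mem _ (Finset.mem_filter.mp hs).1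
  rw [h1, c0card, Finset.card_filter]
  push_cast
  apply Finset.sum_congr rfl
  intro C hC
  obtain ⟨t, ht, rfl⟩ := Finset.mem_image.mp hC
  have h2 : (I.filter (fun s => s + 1 ∈ I)).filter
      (fun s => compOf (cadj N) I s = compOf (cadj N) I t) =
      (compOf (cadj N) I t).filter (fun s => s + 1 ∈ I) := by
    ext s
    simp only [Finset.mem_filter]
    constructor
    · rintro ⟨⟨a, b⟩, c⟩; exact ⟨(compOf_eq_iff a).mp c, b⟩
    · rintro ⟨a, b⟩
      have hs := (mem_compOf.mp a).1
      exact ⟨⟨hs, b⟩, (compOf_eq_iff hs).mpr a⟩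
  rw [h2]
  have h3 := Finset.card_filter_add_card_filter_not (s := compOf (cadj N) I t)
    (fun s => s + 1 ∈ I)
  rw [one_end hN hI ht] at h3
  have key : ∀ n : ℕ, (n : ZMod 2) = 1 ↔ n % 2 = 1 := by
    intro n; rw [← Nat.odd_iff]; exact ZMod.natCast_eq_one_iff_odd
  rw [zmod2_eq_iff, key, ← h3]
  split_ifs with h
  · rw [Nat.even_iff] at h; simp only [true_iff]; omega
  · rw [Nat.even_iff] at h; simp only [zero_ne_one, false_iff]; omega

theorem V0_eq {N : ℕ} [NeZero N] (hN : 3 ≤ N) (hodd : Odd N) :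
    V0set N = {v | Qf v = 0} := by
  ext v
  constructor
  · rintro ⟨I, hI, hev, rfl⟩
    rw [Set.mem_setOf_eq, ← c0card_Qf hN hI, ZMod.natCast_eq_zero_iff_even]
    exact hev
  · intro hv
    rw [Set.mem_setOf_eq] at hv
    have e : v = eSum (eVec N) (Finset.univ.filter (fun s => v s = 1)) := by
      funext s
      rw [eSum_apply]
      have : ∀ x : ZMod 2, x = if x = 1 then 1 else 0 := by decide
      simpa using this (v s)
    have hne : Finset.univ.filter (fun s => v s = 1) ≠ Finset.univ := by
      intro h
      rw [e, h, Qf_eSum] at hv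
      simp only [Finset.mem_univ, Finset.filter_true, Finset.card_univ, ZMod.card] at hv
      rw [ZMod.natCast_eq_zero_iff_even] at hv
      exact (Nat.not_even_iff_odd.mpr hodd) hv
    refine ⟨_, hne, ?_, e⟩
    rw [← ZMod.natCast_eq_zero_iff_even, c0card_Qf hN hne, ← e, hv]

end CycP

/-- `eps(B) ∈ M_B` for every `B ∈ phi(Vbar)`; `B ↦ eps(B)` is a bijection
from `phi(Vbar)` onto `V_0`; and `V_0` equals the union of the `M_B`. -/
theorem statement8 (N : ℕ) [NeZero N] (hN : 3 ≤ N) (hodd : Odd N) :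
    (∀ B ∈ phiSet (cadj N), epsB (eVec N) B ∈ LB (eVec N) B) ∧
    Set.BijOn (epsB (eVec N)) (phiSet (cadj N)) (V0set N) ∧
    V0set N = ⋃ B ∈ phiSet (cadj N),
      ((LB (eVec N) B : Submodule (ZMod 2) (Vc N)) : Set (Vc N)) := by
  have hsurj : ∀ v : Vc N, CycP.Qf v = 0 → ∃ B ∈ phiSet (cadj N), epsB (eVec N) B = v := by
    intro v hv
    obtain ⟨g, hg, hgv⟩ := CycP.wk_surj hN hodd v hv
    refine ⟨CycP.Bof g, CycP.Bof_mem hN hodd hg, ?_⟩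
    funext s
    rw [CycP.epsB_apply, CycP.gs_Bof hN hodd hg, hgv]
  rw [CycP.V0_eq hN hodd]
  refine ⟨fun B hB => CycP.eps_mem hN hB, ⟨?_, ?_, ?_⟩, ?_⟩
  · intro B hB
    exact CycP.Qf_of_mem hN hB (CycP.eps_mem hN hB)
  · intro B hB B' hB' h
    apply CycP.gs_inj hN hB hB'
    apply CycP.wk_inj hodd (CycP.gs_wk hN hB) (CycP.gs_wk hN hB')
    intro s
    rw [← CycP.epsB_apply, ← CycP.epsB_apply]
    exact congrFun h s
  · intro v hv
    obtain ⟨B, hB, h⟩ := hsurj v hv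
    exact ⟨B, hB, h⟩
  · ext v
    simp only [Set.mem_setOf_eq, Set.mem_iUnion, SetLike.mem_coe, exists_prop]
    constructor
    · intro hv
      obtain ⟨B, hB, h⟩ := hsurj v hv
      exact ⟨B, hB, h ▸ CycP.eps_mem hN hB⟩
    · rintro ⟨B, hB, h⟩
      exact CycP.Qf_of_mem hN hB h
end

section
/- Let N ≥ 3 be odd, (S,E) the cycle of length N, Vbar = V/(F·e_S), and fix an edge ee in E. Then the relation ⪯ is a partial order on omega(Vbar). -/
def stp (a b : ℕ) : Prop := a + 1 = b ∨ b + 1 = a ∨ (a = 0 ∧ b = 0)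

def xx (a : ℕ) : ZMod 2 := ((a * (a + 1) / 2 : ℕ) : ZMod 2)

lemma xx_add_two (a : ℕ) : xx (a + 2) = xx a + 1 := by
  unfold xx
  have h : (a + 2) * (a + 2 + 1) / 2 = a * (a + 1) / 2 + 1 + 2 * (a + 1) := by
    have : (a + 2) * (a + 2 + 1) = a * (a + 1) + 2 * (1 + 2 * (a + 1)) := by ring
    rw [this]; omega
  rw [h]
  push_cast
  have : (2 : ZMod 2) = 0 := by decide
  rw [this]; ring

lemma xx_ne (a : ℕ) : xx (a + 2) ≠ xx a := by
  rw [xx_add_two]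
  intro h
  simp at h

lemma xx_stp {a b c : ℕ} (h1 : stp a b) (h2 : stp b c) (h : xx a = xx c) : a = c := by
  have h01 : xx 0 ≠ xx 1 := by unfold xx; decide
  rcases h1 with h1 | h1 | ⟨rfl, rfl⟩ <;> rcases h2 with h2 | h2 | ⟨h2, h3⟩
  · obtain rfl : c = a + 2 := by omega
    exact absurd h.symm (xx_ne a)
  · omega
  · omega
  · omega
  · obtain rfl : a = c + 2 := by omega
    exact absurd h (xx_ne c)
  · obtain rfl : a = 1 := by omega
    subst h3; exact absurd h.symm h01
  · obtain rfl : c = 1 := by omega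
    exact absurd h h01
  · omega
  · omega

lemma core (n : ℕ) : ∀ g u : ℕ → ℕ,
    (∀ i < 2 * n + 1, stp (g i) (g (i + 1))) →
    (∀ i < 2 * n + 1, stp (u i) (u (i + 1))) →
    g 0 = 0 → g (2 * n + 1) = 0 → u 0 = u (2 * n + 1) →
    (∀ i j, i ≤ j → j ≤ 2 * n + 1 → g i = g j → (∀ k, i ≤ k → k ≤ j → g i ≤ g k) →
      xx (u i) = xx (u j)) →
    ∀ i ≤ 2 * n + 1, u i ≤ g i := by
  induction n with
  | zero =>
    intro g u hg hu g0 gN u0 H i hi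
    have h := hu 0 (by omega)
    unfold stp at h
    simp only [Nat.mul_zero, Nat.zero_add] at *
    interval_cases i <;> omega
  | succ n ih =>
    intro g u hg hu g0 gN u0 H
    by_cases hz : ∀ i ≤ 2 * (n + 1) + 1, g i = 0
    · have hx : ∀ i, i + 2 ≤ 2 * (n + 1) + 1 → u i = u (i + 2) := by
        intro i hi
        refine xx_stp (hu i (by omega)) (hu (i + 1) (by omega)) ?_
        refine H i (i + 2) (by omega) hi (by rw [hz i (by omega), hz _ hi]) ?_
        intro k _ _
        rw [hz i (by omega)]; omega
      have h1 : ∀ m, 2 * m + 1 ≤ 2 * (n + 1) + 1 → u (2 * m + 1) = u 1 := by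
        intro m
        induction m with
        | zero => simp
        | succ m ihm =>
          intro hm
          rw [← ihm (by omega), hx (2 * m + 1) (by omega)]
          congr 1
      have h2 : u 0 = u 1 := by rw [u0, h1 (n + 1) le_rfl]
      have h3 := hu 0 (by omega)
      unfold stp at h3
      have h4 : u 0 = 0 := by simp only [Nat.zero_add] at h3; omega
      have h5 : ∀ i, i ≤ 2 * (n + 1) + 1 → u i = 0 := by
        intro i
        induction i using Nat.strong_induction_on with
        | _ i ihi =>
          intro hi
          rcases i with _ | _ | i
          · exact h4
          · simp only [Nat.zero_add]; omega
          · rw [← hx i (by omega)]; exact ihi i (by omega) (by omega)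
      intro i hi
      rw [h5 i hi]; omega
    · push Not at hz
      obtain ⟨s, hs, hmax⟩ := Finset.exists_max_image (Finset.range (2 * (n + 1) + 2)) g
        ⟨0, by simp⟩
      obtain ⟨i0, hi0, hgi0⟩ := hz
      simp only [Finset.mem_range] at hs hmax
      have hpos : 0 < g s := by have := hmax i0 (by omega); omega
      obtain ⟨p, rfl⟩ : ∃ p, s = p + 1 := by
        rcases s with _ | p
        · omega
        · exact ⟨p, rfl⟩
      have hpN : p + 2 ≤ 2 * (n + 1) + 1 := by
        by_contra hc
        have : p + 1 = 2 * (n + 1) + 1 := by omega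
        rw [this] at hpos; omega
      have ha := hg p (by omega)
      have hb := hg (p + 1) (by omega)
      have hma := hmax p (by omega)
      have hmb := hmax (p + 2) (by omega)
      have hA : g (p + 1) = g p + 1 := by unfold stp at ha; omega
      have hB : g (p + 2) = g p := by
        unfold stp at hb; rw [show p + 1 + 1 = p + 2 from rfl] at hb; omega
      have hU : u p = u (p + 2) := by
        refine xx_stp (hu p (by omega)) (hu (p + 1) (by omega)) ?_
        refine H p (p + 2) (by omega) hpN hB.symm ?_
        intro k hk1 hk2
        obtain rfl | rfl | rfl : k = p ∨ k = p + 1 ∨ k = p + 2 := by omega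
        all_goals omega
      let σ : ℕ → ℕ := fun i => if i ≤ p then i else i + 2
      have σle : ∀ i, i ≤ p → σ i = i := fun i hi => if_pos hi
      have σgt : ∀ i, p < i → σ i = i + 2 := fun i hi => if_neg (by omega)
      have hst : ∀ f : ℕ → ℕ, f p = f (p + 2) →
          (∀ i < 2 * (n + 1) + 1, stp (f i) (f (i + 1))) →
          ∀ i < 2 * n + 1, stp (f (σ i)) (f (σ (i + 1))) := by
        intro f hf hfs i hi
        rcases lt_trichotomy i p with h | h | h
        · rw [σle i h.le, σle (i + 1) h]; exact hfs i (by omega)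
        · subst h
          rw [σle i le_rfl, σgt (i + 1) (by omega), hf]
          exact hfs (i + 2) (by omega)
        · rw [σgt i h, σgt (i + 1) (by omega)]
          exact hfs (i + 2) (by omega)
      have hend : ∀ f : ℕ → ℕ, f p = f (p + 2) → f (σ (2 * n + 1)) = f (2 * (n + 1) + 1) := by
        intro f hf
        by_cases h : 2 * n + 1 ≤ p
        · have : p = 2 * n + 1 := by omega
          rw [σle _ h, ← this, hf]
          congr 1; omega
        · rw [σgt _ (by omega)]; congr 1
      have key := ih (fun i => g (σ i)) (fun i => u (σ i)) (hst g hB.symm hg) (hst u hU hu)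
        (by simpa [σle 0 (by omega)] using g0) (by rw [hend g hB.symm]; exact gN)
        (by
          show u (σ 0) = u (σ (2 * n + 1))
          rw [hend u hU, σle 0 (by omega)]; exact u0)
        (by
          intro i j hij hj hgij hk
          have hmono : σ i ≤ σ j := by
            by_cases h1 : i ≤ p <;> by_cases h2 : j ≤ p
            · rw [σle i h1, σle j h2]; exact hij
            · rw [σle i h1, σgt j (by omega)]; omega
            · omega
            · rw [σgt i (by omega), σgt j (by omega)]; omega
          refine H (σ i) (σ j) hmono ?_ hgij ?_
          · by_cases h2 : j ≤ p
            · rw [σle j h2]; omega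
            · rw [σgt j (by omega)]; omega
          · intro k hk1 hk2
            by_cases hkp : k ≤ p
            · have := hk k (by
                by_cases h1 : i ≤ p
                · rwa [σle i h1] at hk1
                · rw [σgt i (by omega)] at hk1; omega) (by
                by_cases h1 : j ≤ p
                · rwa [σle j h1] at hk2
                · omega)
              rwa [σle k hkp] at this
            by_cases hkp2 : p + 2 < k
            · have := hk (k - 2) (by
                by_cases h1 : i ≤ p
                · omega
                · rw [σgt i (by omega)] at hk1; omega) (by
                by_cases h1 : j ≤ p
                · rw [σle j h1] at hk2; omega
                · rw [σgt j (by omega)] at hk2; omega)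
              rwa [σgt (k - 2) (by omega), show k - 2 + 2 = k by omega] at this
            have hip : i ≤ p := by
              by_contra h
              rw [σgt i (by omega)] at hk1; omega
            have hjp : p ≤ j := by
              by_contra h
              rw [σle j (by omega)] at hk2; omega
            have := hk p hip hjp
            rw [σle p le_rfl] at this
            obtain rfl | rfl : k = p + 1 ∨ k = p + 2 := by omega
            all_goals omega)
      have kp : u p ≤ g p := by
        by_cases hpn : p ≤ 2 * n + 1
        · have := key p hpn
          simpa [σle p le_rfl] using this
        · omega
      intro i hi
      rcases lt_or_ge p i with h | h
      · by_cases h3 : p + 2 < i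
        · have := key (i - 2) (by omega)
          rwa [σgt (i - 2) (by omega), show i - 2 + 2 = i by omega] at this
        · obtain rfl | rfl : i = p + 1 ∨ i = p + 2 := by omega
          · have := hu p (by omega)
            unfold stp at this
            omega
          · omega
      · have := key i (by omega)
        rwa [σle i h] at this

section geom
set_option linter.unusedSectionVars false
variable {N : ℕ} [NeZero N]

def arcN (N : ℕ) (a : ZMod N) (m : ℕ) : Finset (ZMod N) :=
  (Finset.range (m + 1)).image (fun i : ℕ => a + (i : ZMod N))


lemma mem_arcN {a z : ZMod N} {m : ℕ} : z ∈ arcN N a m ↔ ∃ i ≤ m, a + (i : ZMod N) = z := by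
  simp [arcN]

lemma cast_injN {i j : ℕ} (hi : i < N) (hj : j < N) (h : (i : ZMod N) = (j : ZMod N)) : i = j := by
  have := (ZMod.natCast_eq_natCast_iff' i j N).1 h
  rwa [Nat.mod_eq_of_lt hi, Nat.mod_eq_of_lt hj] at this

lemma cadj_symm {x y : ZMod N} (h : cadj N x y) : cadj N y x := h.symm

lemma cadj_cast {a : ZMod N} {i j : ℕ} (hi : i + 1 < N) (hj : j + 1 < N) :
    cadj N (a + (i : ZMod N)) (a + (j : ZMod N)) ↔ (i + 1 = j ∨ j + 1 = i) := by
  unfold cadj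
  constructor
  · rintro (h | h)
    · left
      apply cast_injN hi (by omega)
      push_cast
      linear_combination -h
    · right
      apply cast_injN hj (by omega)
      push_cast
      linear_combination -h
  · rintro (h | h)
    · left; rw [← h]; push_cast; ring
    · right; rw [← h]; push_cast; ring

lemma arcN_card {a : ZMod N} {m : ℕ} (hm : m + 2 ≤ N) : (arcN N a m).card = m + 1 := by
  unfold arcN
  rw [Finset.card_image_of_injOn, Finset.card_range]
  intro i hi j hj h
  simp only [Finset.coe_range, Set.mem_Iio] at hi hj
  exact cast_injN (by omega) (by omega) (add_left_cancel h)

lemma arcN_cal {a : ZMod N} {m : ℕ} (he : Even m) (hm : m + 2 ≤ N) :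
    CalI1 (cadj N) (arcN N a m) := by
  refine ⟨⟨m, fun i => a + ((i : ℕ) : ZMod N), ?_, ?_, ?_⟩, ?_⟩
  · intro i j h
    apply Fin.ext
    exact cast_injN (by omega) (by omega) (add_left_cancel h)
  · ext z
    rw [mem_arcN]
    simp only [Finset.mem_image, Finset.mem_univ, true_and]
    constructor
    · rintro ⟨i, hi, h⟩
      exact ⟨⟨i, by omega⟩, h⟩
    · rintro ⟨i, h⟩
      exact ⟨i, by omega, h⟩
  · intro i j
    exact cadj_cast (by omega) (by omega)
  · rw [arcN_card hm]
    exact he.add_one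

lemma cal_arcN (hN : 3 ≤ N) (hodd : Odd N) {I : Finset (ZMod N)} (h : CalI1 (cadj N) I) :
    ∃ a m, Even m ∧ m + 2 ≤ N ∧ I = arcN N a m := by
  obtain ⟨⟨m, f, finj, hI, hadj⟩, hc⟩ := h
  have hcard : I.card = m + 1 := by
    rw [hI, Finset.card_image_of_injective _ finj]; simp
  have hle : m + 1 ≤ N := by
    have := Fintype.card_le_of_injective f finj
    simpa [ZMod.card] using this
  have hev : Even m := by
    rw [hcard] at hc
    exact (Nat.odd_add_one.1 hc |> Nat.not_odd_iff_even.1)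
  obtain ⟨F, hF⟩ : ∃ F : ℕ → ZMod N, ∀ i : Fin (m + 1), F i = f i :=
    ⟨fun i => if h : i < m + 1 then f ⟨i, h⟩ else 0, fun i => dif_pos i.2⟩
  have Finj : ∀ i j, i ≤ m → j ≤ m → F i = F j → i = j := by
    intro i j hi hj h
    have h1 := hF ⟨i, by omega⟩
    have h2 := hF ⟨j, by omega⟩
    simp only at h1 h2
    rw [h1, h2] at h
    simpa using finj h
  have Fadj : ∀ i j, i ≤ m → j ≤ m → (cadj N (F i) (F j) ↔ (i + 1 = j ∨ j + 1 = i)) := by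
    intro i j hi hj
    have h1 := hF ⟨i, by omega⟩
    have h2 := hF ⟨j, by omega⟩
    simp only at h1 h2
    rw [h1, h2]
    exact hadj _ _
  have FI : ∀ z, z ∈ I ↔ ∃ i ≤ m, F i = z := by
    intro z
    rw [hI]
    simp only [Finset.mem_image, Finset.mem_univ, true_and]
    constructor
    · rintro ⟨i, rfl⟩
      exact ⟨i, by omega, hF i⟩
    · rintro ⟨i, hi, rfl⟩
      exact ⟨⟨i, by omega⟩, (hF ⟨i, by omega⟩).symm⟩
  obtain ⟨δ, hδ, hstep⟩ : ∃ δ : ZMod N, (δ = 1 ∨ δ = -1) ∧ ∀ i, i < m → F (i + 1) = F i + δ := by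
    rcases Nat.eq_zero_or_pos m with rfl | hm
    · exact ⟨1, Or.inl rfl, by omega⟩
    · have h01 := (Fadj 0 1 (by omega) hm).2 (by omega)
      refine ⟨F 1 - F 0, ?_, ?_⟩
      · rcases h01 with h | h
        · left; rw [h]; ring
        · right; rw [h]; ring
      · intro i
        induction i with
        | zero => intro _; ring
        | succ i ih =>
          intro hi
          have h1 := ih (by omega)
          have h2 := (Fadj (i + 1) (i + 1 + 1) (by omega) (by omega)).2 (by omega)
          have h3 : F (i + 1 + 1) ≠ F i := fun h => by
            have := Finj _ _ (by omega) (by omega) h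
            omega
          have h4 : cadj N (F i) (F (i + 1)) := (Fadj i (i + 1) (by omega) (by omega)).2 (by omega)
          have h5 : F 1 - F 0 = F (i + 1) - F i := by rw [h1]; ring
          rw [h5]
          rcases h2 with h2 | h2 <;> rcases h4 with h4 | h4
          · rw [h2, h4]; ring
          · exact absurd (h2.trans h4.symm) h3
          · exact absurd (add_right_cancel (h2.symm.trans h4)) h3
          · linear_combination h4 - h2
  have hform : ∀ i, i ≤ m → F i = F 0 + δ * (i : ZMod N) := by
    intro i
    induction i with
    | zero => intro _; simp
    | succ i ih =>
      intro hi
      rw [hstep i (by omega), ih (by omega)]; push_cast; ring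
  have hlt : m + 2 ≤ N := by
    by_contra hc
    have hmN : m + 1 = N := by omega
    have hm1 : ((m : ℕ) : ZMod N) = -1 := by
      have : ((m + 1 : ℕ) : ZMod N) = 0 := by rw [hmN]; simp
      push_cast at this
      linear_combination this
    have h0 := hform m le_rfl
    rw [hm1] at h0
    have := (Fadj 0 m (by omega) le_rfl).1 (by
      unfold cadj
      rcases hδ with rfl | rfl
      · right; rw [h0]; ring
      · left; rw [h0]; ring)
    omega
  rcases hδ with rfl | rfl
  · refine ⟨F 0, m, hev, hlt, ?_⟩
    ext z
    rw [FI, mem_arcN]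
    constructor
    · rintro ⟨i, hi, rfl⟩
      exact ⟨i, hi, by rw [hform i hi]; ring⟩
    · rintro ⟨i, hi, rfl⟩
      exact ⟨i, hi, by rw [hform i hi]; ring⟩
  · refine ⟨F m, m, hev, hlt, ?_⟩
    ext z
    rw [FI, mem_arcN]
    constructor
    · rintro ⟨i, hi, rfl⟩
      refine ⟨m - i, by omega, ?_⟩
      rw [hform i hi, hform m le_rfl, Nat.cast_sub hi]; ring
    · rintro ⟨i, hi, rfl⟩
      refine ⟨m - i, by omega, ?_⟩
      rw [hform (m - i) (by omega), hform m le_rfl, Nat.cast_sub hi]; ring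

lemma conn_seg {X : Finset (ZMod N)} (f : ℕ → ZMod N) (hf : ∀ i, cadj N (f i) (f (i + 1)))
    (p q : ℕ) (hX : ∀ z, z ∈ X ↔ ∃ i, p ≤ i ∧ i ≤ q ∧ f i = z) : ConnOn (cadj N) X := by
  have up : ∀ d i, p ≤ i → i + d ≤ q →
      Relation.ReflTransGen (fun a b => a ∈ X ∧ b ∈ X ∧ cadj N a b) (f i) (f (i + d)) ∧
      Relation.ReflTransGen (fun a b => a ∈ X ∧ b ∈ X ∧ cadj N a b) (f (i + d)) (f i) := by
    intro d
    induction d with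
    | zero => intro i _ _; exact ⟨.refl, .refl⟩
    | succ d ih =>
      intro i h1 h2
      obtain ⟨h3, h4⟩ := ih i h1 (by omega)
      have m1 : f (i + d) ∈ X := (hX _).2 ⟨i + d, by omega, by omega, rfl⟩
      have m2 : f (i + d + 1) ∈ X := (hX _).2 ⟨i + d + 1, by omega, by omega, rfl⟩
      exact ⟨h3.tail ⟨m1, m2, hf _⟩, .head ⟨m2, m1, cadj_symm (hf _)⟩ h4⟩
  intro s hs t ht
  obtain ⟨i, hi1, hi2, rfl⟩ := (hX s).1 hs
  obtain ⟨j, hj1, hj2, rfl⟩ := (hX t).1 ht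
  rcases le_total i j with h | h
  · obtain ⟨d, rfl⟩ := Nat.exists_eq_add_of_le h
    exact (up d i hi1 hj2).1
  · obtain ⟨d, rfl⟩ := Nat.exists_eq_add_of_le h
    exact (up d j hj1 hi2).2

lemma cadj_lin {s δ : ZMod N} (hδ : δ = 1 ∨ δ = -1) (i : ℕ) :
    cadj N (s + δ * (i : ZMod N)) (s + δ * ((i + 1 : ℕ) : ZMod N)) := by
  unfold cadj
  rcases hδ with rfl | rfl
  · left; push_cast; ring
  · right; push_cast; ring

lemma conn_cal (hN : 3 ≤ N) (hodd : Odd N) {I : Finset (ZMod N)} (h : CalI1 (cadj N) I) :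
    ConnOn (cadj N) I := by
  obtain ⟨a, m, -, -, rfl⟩ := cal_arcN hN hodd h
  refine conn_seg (fun i => a + 1 * (i : ZMod N)) (cadj_lin (Or.inl rfl)) 0 m ?_
  intro z
  simp [mem_arcN]

lemma conn_union {X Y : Finset (ZMod N)} (hX : ConnOn (cadj N) X) (hY : ConnOn (cadj N) Y)
    {x y : ZMod N} (hx : x ∈ X) (hy : y ∈ Y) (h : cadj N x y) : ConnOn (cadj N) (X ∪ Y) := by
  have mX : ∀ s ∈ X, ∀ t ∈ X,
      Relation.ReflTransGen (fun a b => a ∈ X ∪ Y ∧ b ∈ X ∪ Y ∧ cadj N a b) s t :=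
    fun s hs t ht => Relation.ReflTransGen.mono (fun a b ⟨h1, h2, h3⟩ =>
      ⟨Finset.mem_union_left _ h1, Finset.mem_union_left _ h2, h3⟩) _ _ (hX s hs t ht)
  have mY : ∀ s ∈ Y, ∀ t ∈ Y,
      Relation.ReflTransGen (fun a b => a ∈ X ∪ Y ∧ b ∈ X ∪ Y ∧ cadj N a b) s t :=
    fun s hs t ht => Relation.ReflTransGen.mono (fun a b ⟨h1, h2, h3⟩ =>
      ⟨Finset.mem_union_right _ h1, Finset.mem_union_right _ h2, h3⟩) _ _ (hY s hs t ht)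
  have hx' := Finset.mem_union_left Y hx
  have hy' := Finset.mem_union_right X hy
  intro s hs t ht
  rcases Finset.mem_union.1 hs with hs | hs <;> rcases Finset.mem_union.1 ht with ht | ht
  · exact mX s hs t ht
  · exact ((mX s hs x hx).tail ⟨hx', hy', h⟩).trans (mY y hy t ht)
  · exact ((mY s hs y hy).tail ⟨hy', hx', cadj_symm h⟩).trans (mX x hx t ht)
  · exact mY s hs t ht

/-- an odd arc with `s` as an end, outward direction `-δ`. -/
lemma cal_end (hN : 3 ≤ N) (hodd : Odd N) {I : Finset (ZMod N)} (h : CalI1 (cadj N) I)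
    {s δ : ZMod N} (hδ : δ = 1 ∨ δ = -1) (hs : s ∈ I) (hs' : s - δ ∉ I) :
    ∃ m, m + 2 ≤ N ∧ ∀ z, z ∈ I ↔ ∃ i ≤ m, s + δ * (i : ZMod N) = z := by
  obtain ⟨a, m, -, hm, rfl⟩ := cal_arcN hN hodd h
  refine ⟨m, hm, ?_⟩
  obtain ⟨i, hi, rfl⟩ := mem_arcN.1 hs
  rw [mem_arcN] at hs'
  rcases hδ with rfl | rfl
  · have : i = 0 := by
      rcases i with _ | i
      · rfl
      · exact absurd ⟨i, by omega, by push_cast; ring⟩ hs'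
    subst this
    intro z
    simp [mem_arcN]
  · have : i = m := by
      by_contra hne
      exact hs' ⟨i + 1, by omega, by push_cast; ring⟩
    subst this
    intro z
    rw [mem_arcN]
    constructor
    · rintro ⟨j, hj, rfl⟩
      exact ⟨i - j, by omega, by rw [Nat.cast_sub hj]; ring⟩
    · rintro ⟨j, hj, rfl⟩
      exact ⟨i - j, by omega, by rw [Nat.cast_sub hj]; ring⟩

lemma not_prec_end (hN : 3 ≤ N) (hodd : Odd N) {I J : Finset (ZMod N)} (hI : CalI1 (cadj N) I)
    (hJ : CalI1 (cadj N) J) {s δ : ZMod N} (hδ : δ = 1 ∨ δ = -1)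
    (h1 : s ∈ I) (h2 : s - δ ∉ I) (h3 : s ∈ J) (h4 : s - δ ∉ J) : ¬ Prec (cadj N) I J := by
  obtain ⟨m, hm, hmI⟩ := cal_end hN hodd hI hδ h1 h2
  obtain ⟨n, hn, hnJ⟩ := cal_end hN hodd hJ hδ h3 h4
  rintro ⟨-, hc⟩
  apply hc
  refine conn_seg (fun i => s + δ * (i : ZMod N)) (cadj_lin hδ) (m + 1) n ?_
  intro z
  rw [Finset.mem_sdiff, hmI, hnJ]
  constructor
  · rintro ⟨⟨i, hi, rfl⟩, hni⟩
    refine ⟨i, ?_, hi, rfl⟩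
    by_contra hlt
    exact hni ⟨i, by omega, rfl⟩
  · rintro ⟨i, hi1, hi2, rfl⟩
    refine ⟨⟨i, hi2, rfl⟩, ?_⟩
    rintro ⟨j, hj, h⟩
    have h5 : (j : ZMod N) = (i : ZMod N) := by
      have h6 := add_left_cancel h
      rcases hδ with rfl | rfl
      · simpa using h6
      · simpa using h6
    have := cast_injN (by omega) (by omega) h5
    omega

lemma iev_arcN {a : ZMod N} {m j : ℕ} (he : Even m) (hm : m + 2 ≤ N) (hj : Odd j) (hjm : j < m) :
    a + (j : ZMod N) ∈ Iev (cadj N) (arcN N a m) := by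
  obtain ⟨i, rfl⟩ := hj
  refine ⟨mem_arcN.2 ⟨_, hjm.le, rfl⟩, arcN N a (2 * i),
    arcN N (a + ((2 * i + 2 : ℕ) : ZMod N)) (m - (2 * i + 2)), arcN_cal ⟨i, by ring⟩ (by omega),
    arcN_cal (by
      obtain ⟨r, hr⟩ := he
      exact ⟨r - (i + 1), by omega⟩) (by omega), ?_, ?_⟩
  · have hY : ∀ z, z ∈ arcN N (a + ((2 * i + 2 : ℕ) : ZMod N)) (m - (2 * i + 2)) →
        ∃ k, 2 * i + 2 ≤ k ∧ k ≤ m ∧ a + (k : ZMod N) = z := by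
      intro z hz
      obtain ⟨k, hk, rfl⟩ := mem_arcN.1 hz
      refine ⟨2 * i + 2 + k, by omega, by obtain ⟨r, hr⟩ := he; omega, by push_cast; ring⟩
    have hdis : ∀ z, z ∈ arcN N a (2 * i) →
        z ∉ arcN N (a + ((2 * i + 2 : ℕ) : ZMod N)) (m - (2 * i + 2)) := by
      intro z h1 h2
      obtain ⟨k, hk, rfl⟩ := mem_arcN.1 h1
      obtain ⟨l, hl1, hl2, h⟩ := hY _ h2
      have := cast_injN (by omega) (by omega) (add_left_cancel h)
      omega
    refine ⟨Finset.disjoint_iff_inter_eq_empty.1 (Finset.disjoint_left.2 hdis), ?_⟩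
    intro hconn
    have ha : a ∈ arcN N a (2 * i) := mem_arcN.2 ⟨0, by omega, by simp⟩
    have hb : a + ((2 * i + 2 : ℕ) : ZMod N) ∈
        arcN N (a + ((2 * i + 2 : ℕ) : ZMod N)) (m - (2 * i + 2)) :=
      mem_arcN.2 ⟨0, by omega, by simp⟩
    have hr := hconn a (Finset.mem_union_left _ ha) _ (Finset.mem_union_right _ hb)
    refine hdis _ ?_ hb
    clear hb
    generalize arcN N (a + ((2 * i + 2 : ℕ) : ZMod N)) (m - (2 * i + 2)) = Y at *
    generalize a + ((2 * i + 2 : ℕ) : ZMod N) = w at hr ⊢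
    induction hr with
    | refl => exact ha
    | tail _ hst ih =>
      obtain ⟨-, h2, h3⟩ := hst
      rcases Finset.mem_union.1 h2 with h2 | h2
      · exact h2
      · exfalso
        obtain ⟨k, hk, rfl⟩ := mem_arcN.1 ih
        obtain ⟨l, hl1, hl2, rfl⟩ := hY _ h2
        have := (cadj_cast (by omega) (by omega)).1 h3
        omega
  · ext z
    rw [Finset.mem_erase, Finset.mem_union, mem_arcN, mem_arcN, mem_arcN]
    constructor
    · rintro ⟨hne, k, hk, rfl⟩
      rcases lt_trichotomy k (2 * i + 1) with h | h | h
      · exact Or.inl ⟨k, by omega, rfl⟩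
      · exact absurd (by rw [h]) hne
      · refine Or.inr ⟨k - (2 * i + 2), by omega, ?_⟩
        rw [Nat.cast_sub (by omega)]; ring
    · rintro (⟨k, hk, rfl⟩ | ⟨k, hk, rfl⟩)
      · refine ⟨?_, k, by omega, rfl⟩
        intro h
        have := cast_injN (by omega) (by omega) (add_left_cancel h)
        omega
      · refine ⟨?_, 2 * i + 2 + k, by obtain ⟨r, hr⟩ := he; omega, by push_cast; ring⟩
        intro h
        have h' : a + ((2 * i + 2 + k : ℕ) : ZMod N) = a + ((2 * i + 1 : ℕ) : ZMod N) := by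
          rw [← h]; push_cast; ring
        have := cast_injN (by obtain ⟨r, hr⟩ := he; omega) (by omega) (add_left_cancel h')
        omega

end geom

section fam
set_option linter.unusedSectionVars false
variable {N : ℕ} [NeZero N]

lemma nest_mem {B : Finset (Finset (ZMod N))} (hB : B ∈ phiSet (cadj N))
    {I J : Finset (ZMod N)} (hI : I ∈ B) (hJ : J ∈ B) {x : ZMod N} (h1 : x ∈ I) (h2 : x ∈ J) :
    I = J ∨ Prec (cadj N) I J ∨ Prec (cadj N) J I := by
  rcases hB.2.1 I hI J hJ with h | h | h
  · exact Or.inl h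
  · have : x ∈ I ∩ J := Finset.mem_inter.2 ⟨h1, h2⟩
    rw [h.1] at this
    simp at this
  · exact Or.inr h

lemma nest_adj (hN : 3 ≤ N) (hodd : Odd N) {B : Finset (Finset (ZMod N))}
    (hB : B ∈ phiSet (cadj N)) {I J : Finset (ZMod N)} (hI : I ∈ B) (hJ : J ∈ B)
    {x y : ZMod N} (h1 : x ∈ I) (h2 : y ∈ J) (h3 : cadj N x y) (h4 : y ∉ I) : I ⊆ J := by
  rcases hB.2.1 I hI J hJ with h | h | h | h
  · exact h.subset
  · exact absurd (conn_union (conn_cal hN hodd (hB.1 I hI)) (conn_cal hN hodd (hB.1 J hJ)) h1 h2 h3)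
      h.2
  · exact h.1.subset
  · exact absurd (h.1.subset h2) h4

lemma end_eq (hN : 3 ≤ N) (hodd : Odd N) {B : Finset (Finset (ZMod N))}
    (hB : B ∈ phiSet (cadj N)) {I J : Finset (ZMod N)} (hI : I ∈ B) (hJ : J ∈ B)
    {s δ : ZMod N} (hδ : δ = 1 ∨ δ = -1)
    (h1 : s ∈ I) (h2 : s - δ ∉ I) (h3 : s ∈ J) (h4 : s - δ ∉ J) : I = J := by
  rcases nest_mem hB hI hJ h1 h3 with h | h | h
  · exact h
  · exact absurd h (not_prec_end hN hodd (hB.1 I hI) (hB.1 J hJ) hδ h1 h2 h3 h4)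
  · exact absurd h (not_prec_end hN hodd (hB.1 J hJ) (hB.1 I hI) hδ h3 h4 h1 h2)

lemma exit_lt (hN : 3 ≤ N) (hodd : Odd N) {B : Finset (Finset (ZMod N))}
    (hB : B ∈ phiSet (cadj N)) {I : Finset (ZMod N)} (hI : I ∈ B) {a y z : ZMod N}
    (ha : a ∈ I) (hy : y ∈ I) (hz : z ∉ I) (h : cadj N y z) : gs B z < gs B a := by
  unfold gs
  apply Finset.card_lt_card
  rw [Finset.ssubset_iff_of_subset]
  · exact ⟨I, by simp [hI, ha], by simp [hz]⟩
  · intro K hK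
    rw [Finset.mem_filter] at hK ⊢
    exact ⟨hK.1, nest_adj hN hodd hB hI hK.1 hy hK.2 h hz ha⟩

lemma conn_sub (hN : 3 ≤ N) (hodd : Odd N) {B : Finset (Finset (ZMod N))}
    (hB : B ∈ phiSet (cadj N)) {I X : Finset (ZMod N)} (hI : I ∈ B) {a : ZMod N}
    (ha : a ∈ I) (hX : ConnOn (cadj N) X) (haX : a ∈ X) (hg : ∀ x ∈ X, gs B a ≤ gs B x) :
    X ⊆ I := by
  intro x hx
  have hr := hX a haX x hx
  clear hx
  induction hr with
  | refl => exact ha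
  | tail _ hst ih =>
    obtain ⟨_, h2, h3⟩ := hst
    by_contra hc
    have h4 := exit_lt hN hodd hB hI ha ih hc h3
    have h5 := hg _ h2
    omega

lemma gs_owner {B : Finset (Finset (ZMod N))} {I : Finset (ZMod N)} {a x : ZMod N}
    (how : ∀ J ∈ B, a ∈ J → I ⊆ J) (hx : x ∈ I) : gs B a ≤ gs B x := by
  unfold gs
  apply Finset.card_le_card
  intro K hK
  rw [Finset.mem_filter] at hK ⊢
  exact ⟨hK.1, how K hK.1 hK.2 hx⟩

lemma exists_min_mem {B : Finset (Finset (ZMod N))} (hB : B ∈ phiSet (cadj N)) {s : ZMod N}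
    (h : 0 < gs B s) : ∃ I ∈ B, s ∈ I ∧ ∀ J ∈ B, s ∈ J → I ⊆ J := by
  obtain ⟨I, hI, hmin⟩ := Finset.exists_min_image (B.filter (fun I => s ∈ I)) Finset.card
    (Finset.card_pos.1 h)
  rw [Finset.mem_filter] at hI
  refine ⟨I, hI.1, hI.2, ?_⟩
  intro J hJ hs
  rcases nest_mem hB hI.1 hJ hI.2 hs with h | h | h
  · exact h.subset
  · exact h.1.subset
  · have h1 := Finset.card_lt_card h.1
    have h2 := hmin J (Finset.mem_filter.2 ⟨hJ, hs⟩)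
    omega

lemma gs_inj_sub (hN : 3 ≤ N) (hodd : Odd N) {B B' : Finset (Finset (ZMod N))}
    (hB : B ∈ phiSet (cadj N)) (hB' : B' ∈ phiSet (cadj N)) (h : ∀ s, gs B s = gs B' s) :
    B ⊆ B' := by
  intro I hI
  obtain ⟨a, m, -, hm, hIa⟩ := cal_arcN hN hodd (hB.1 I hI)
  have ha : a ∈ I := by rw [hIa]; exact mem_arcN.2 ⟨0, by omega, by simp⟩
  have ha' : a - 1 ∉ I := by
    rw [hIa, mem_arcN]
    rintro ⟨i, hi, h⟩
    have h1 : ((i + 1 : ℕ) : ZMod N) = ((0 : ℕ) : ZMod N) := by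
      push_cast; linear_combination h
    have := cast_injN (by omega) (by omega) h1
    omega
  have how : ∀ J ∈ B, a ∈ J → I ⊆ J := by
    intro J hJ haJ
    by_cases h1 : a - 1 ∈ J
    · exact nest_adj hN hodd hB hI hJ ha h1 (Or.inr (by ring)) ha'
    · exact (end_eq hN hodd hB hI hJ (Or.inl rfl) ha ha' haJ h1).subset
  have hpos : 0 < gs B a := Finset.card_pos.2 ⟨I, Finset.mem_filter.2 ⟨hI, ha⟩⟩
  obtain ⟨J, hJ, haJ, hmin⟩ := exists_min_mem hB' (s := a) (by rw [← h]; exact hpos)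
  have e1 : J ⊆ I := conn_sub hN hodd hB hI ha (conn_cal hN hodd (hB'.1 J hJ)) haJ (by
    intro x hx
    rw [h, h]
    exact gs_owner hmin hx)
  have e2 : I ⊆ J := conn_sub hN hodd hB' hJ haJ (conn_cal hN hodd (hB.1 I hI)) ha (by
    intro x hx
    rw [← h, ← h]
    exact gs_owner how hx)
  rw [e2.antisymm e1]
  exact hJ

lemma gs_step (hN : 3 ≤ N) (hodd : Odd N) {B : Finset (Finset (ZMod N))}
    (hB : B ∈ phiSet (cadj N)) (s : ZMod N) : stp (gs B s) (gs B (s + 1)) := by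
  classical
  by_cases h1 : ∃ J ∈ B, s ∈ J ∧ s + 1 ∉ J
  · obtain ⟨J, hJ, hs, hs'⟩ := h1
    right; left
    have : B.filter (fun I => s ∈ I) = insert J (B.filter (fun I => s + 1 ∈ I)) := by
      ext K
      simp only [Finset.mem_insert, Finset.mem_filter]
      constructor
      · rintro ⟨hK, hsK⟩
        by_cases hc : s + 1 ∈ K
        · exact Or.inr ⟨hK, hc⟩
        · left
          exact end_eq hN hodd hB hK hJ (δ := -1) (Or.inr rfl) hsK (by simpa using hc) hs
            (by simpa using hs')
      · rintro (rfl | ⟨hK, hsK⟩)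
        · exact ⟨hJ, hs⟩
        · exact ⟨hK, nest_adj hN hodd hB hJ hK hs hsK (Or.inl rfl) hs' hs⟩
    unfold gs
    rw [this, Finset.card_insert_of_notMem (by simp [hs'])]
  by_cases h2 : ∃ J ∈ B, s + 1 ∈ J ∧ s ∉ J
  · obtain ⟨J, hJ, hs, hs'⟩ := h2
    left
    have : B.filter (fun I => s + 1 ∈ I) = insert J (B.filter (fun I => s ∈ I)) := by
      ext K
      simp only [Finset.mem_insert, Finset.mem_filter]
      constructor
      · rintro ⟨hK, hsK⟩
        by_cases hc : s ∈ K
        · exact Or.inr ⟨hK, hc⟩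
        · left
          exact end_eq hN hodd hB hK hJ (δ := 1) (Or.inl rfl) hsK (by simpa using hc) hs
            (by simpa using hs')
      · rintro (rfl | ⟨hK, hsK⟩)
        · exact ⟨hJ, hs⟩
        · exact ⟨hK, nest_adj hN hodd hB hJ hK hs hsK (Or.inr rfl) hs' hs⟩
    unfold gs
    rw [this, Finset.card_insert_of_notMem (by simp [hs'])]
  push Not at h1 h2
  have heq : gs B s = gs B (s + 1) := by
    unfold gs
    congr 1
    ext K
    simp only [Finset.mem_filter]
    exact ⟨fun ⟨a, b⟩ => ⟨a, h1 K a b⟩, fun ⟨a, b⟩ => ⟨a, h2 K a b⟩⟩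
  rcases Nat.eq_zero_or_pos (gs B s) with h0 | hpos
  · exact Or.inr (Or.inr ⟨h0, by omega⟩)
  · exfalso
    obtain ⟨I, hI, hs, hmin⟩ := exists_min_mem hB hpos
    have hs1 := h1 I hI hs
    obtain ⟨a, m, he, hm, hIa⟩ := cal_arcN hN hodd (hB.1 I hI)
    have hmm := hs
    have hmm1 := hs1
    rw [hIa, mem_arcN] at hmm hmm1
    obtain ⟨i, hi, hia⟩ := hmm
    obtain ⟨j, hj, hja⟩ := hmm1
    have hij : j = i + 1 := by
      apply cast_injN (N := N) (by omega) (by omega)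
      push_cast
      linear_combination hja - hia
    have hev : s ∈ Iev (cadj N) I ∨ s + 1 ∈ Iev (cadj N) I := by
      rw [hIa]
      rcases Nat.even_or_odd i with hei | hoi
      · right
        rw [← hja]
        have : Odd j := hij ▸ hei.add_one
        refine iev_arcN he hm this ?_
        rcases hj.lt_or_eq with h | h
        · exact h
        · rw [h] at this
          exact absurd he (Nat.not_even_iff_odd.2 this)
      · left
        rw [← hia]
        exact iev_arcN he hm hoi (by omega)
    obtain ⟨k, f, hf, -, hcov⟩ := hB.2.2 I hI
    have : ∃ l, s ∈ f l := by
      rcases hev with h | h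
      · simpa using hcov h
      · obtain ⟨l, hl⟩ := Set.mem_iUnion.1 (hcov h)
        exact ⟨l, h2 _ (hf l).1 (by simpa using hl)⟩
    obtain ⟨l, hl⟩ := this
    exact (hf l).2.1.not_subset (hmin _ (hf l).1 hl)

lemma gs_zero (hN : 3 ≤ N) (hodd : Odd N) {B : Finset (Finset (ZMod N))}
    (hB : B ∈ phiSet (cadj N)) : ∃ s, gs B s = 0 := by
  by_contra hc
  push Not at hc
  have h : ∀ k : ℕ, (gs B ((k : ℕ) : ZMod N) + k) % 2 = gs B 0 % 2 := by
    intro k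
    induction k with
    | zero => simp
    | succ k ih =>
      have h1 := gs_step hN hodd hB ((k : ℕ) : ZMod N)
      have h2 := hc ((k : ℕ) : ZMod N)
      push_cast
      unfold stp at h1
      omega
  have h1 := h N
  obtain ⟨r, hr⟩ := hodd
  simp only [ZMod.natCast_self] at h1
  omega

lemma rel_mem (hN : 3 ≤ N) (hodd : Odd N) {B : Finset (Finset (ZMod N))}
    (hB : B ∈ phiSet (cadj N)) (s0 : ZMod N) {i j : ℕ} (hij : i ≤ j)
    (h1 : gs B (s0 + (i : ZMod N)) = gs B (s0 + (j : ZMod N)))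
    (h2 : ∀ k : ℕ, i ≤ k → k ≤ j → gs B (s0 + (i : ZMod N)) ≤ gs B (s0 + (k : ZMod N))) :
    ∀ I ∈ B, (s0 + (i : ZMod N) ∈ I ↔ s0 + (j : ZMod N) ∈ I) := by
  have hsub : ∀ k, i ≤ k → k ≤ j → ∀ I ∈ B, s0 + (i : ZMod N) ∈ I → s0 + (k : ZMod N) ∈ I := by
    intro k hk
    induction k, hk using Nat.le_induction with
    | base => intro _ I _ h; exact h
    | succ k hk ih =>
      intro hkj I hI h
      by_contra hc
      have h3 := exit_lt hN hodd hB hI h (ih (by omega) I hI h) hc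
        (Or.inl (by push_cast; ring))
      have h4 := h2 (k + 1) (by omega) hkj
      omega
  have hS : B.filter (fun I => s0 + (i : ZMod N) ∈ I) ⊆ B.filter (fun I => s0 + (j : ZMod N) ∈ I) := by
    intro I hI
    rw [Finset.mem_filter] at hI ⊢
    exact ⟨hI.1, hsub j hij le_rfl I hI.1 hI.2⟩
  have hE := Finset.eq_of_subset_of_card_le hS (by unfold gs at h1; omega)
  intro I hI
  refine ⟨hsub j hij le_rfl I hI, fun h => ?_⟩
  have : I ∈ B.filter (fun I => s0 + (j : ZMod N) ∈ I) := Finset.mem_filter.2 ⟨hI, h⟩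
  rw [← hE] at this
  exact (Finset.mem_filter.1 this).2

lemma zee_ebar (i j s : ZMod N) :
    zee N i j (ebar N s) = (if s = i then 1 else 0) + (if s = j then 1 else 0) := by
  have : zee N i j (ebar N s) = zeeV N i j (eVec N s) := by
    unfold zee ebar piQ
    exact Submodule.liftQ_apply _ _ _
  rw [this]
  simp [zeeV, eVec, Pi.single_apply, eq_comm]

lemma zee_const {B : Finset (Finset (ZMod N))} {i j : ZMod N}
    (h : ∀ I ∈ B, (i ∈ I ↔ j ∈ I)) {v : VbarN N} (hv : v ∈ LB (ebar N) B) : zee N i j v = 0 := by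
  have : LB (ebar N) B ≤ LinearMap.ker (zee N i j) := by
    unfold LB
    rw [Submodule.span_le]
    rintro _ ⟨I, hI, rfl⟩
    have hI' := h I hI
    simp only [SetLike.mem_coe, LinearMap.mem_ker, eSum, map_sum, zee_ebar,
      Finset.sum_add_distrib, Finset.sum_ite_eq']
    by_cases h1 : i ∈ I
    · rw [if_pos h1, if_pos (hI'.1 h1)]; decide
    · rw [if_neg h1, if_neg (fun h2 => h1 (hI'.2 h2))]; simp
  exact LinearMap.mem_ker.1 (this hv)

lemma zee_eps (B : Finset (Finset (ZMod N))) (i j : ZMod N) :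
    zee N i j (epsB (ebar N) B) = xx (gs B i) + xx (gs B j) := by
  unfold epsB
  simp only [map_sum, map_smul, zee_ebar, smul_eq_mul, mul_add, Finset.sum_add_distrib,
    mul_ite, mul_one, mul_zero, Finset.sum_ite_eq', Finset.mem_univ, if_true]
  rfl

lemma gs_le (hN : 3 ≤ N) (hodd : Odd N) {B B' : Finset (Finset (ZMod N))}
    (hB : B ∈ phiSet (cadj N)) (hB' : B' ∈ phiSet (cadj N))
    (h : epsB (ebar N) B' ∈ LB (ebar N) B) (s : ZMod N) : gs B' s ≤ gs B s := by
  obtain ⟨s0, hs0⟩ := gs_zero hN hodd hB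
  obtain ⟨n, hn⟩ := hodd
  have hodd : Odd N := ⟨n, hn⟩
  have hNz : ((2 * n + 1 : ℕ) : ZMod N) = 0 := by rw [← hn]; simp
  have key := core n (fun k => gs B (s0 + (k : ZMod N))) (fun k => gs B' (s0 + (k : ZMod N)))
    (by
      intro i _
      have := gs_step hN hodd hB (s0 + (i : ZMod N))
      simpa [add_assoc] using this)
    (by
      intro i _
      have := gs_step hN hodd hB' (s0 + (i : ZMod N))
      simpa [add_assoc] using this)
    (by simpa using hs0) (by simp only [hNz, add_zero]; exact hs0)
    (by simp only [hNz, Nat.cast_zero])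
    (by
      intro i j hij hj h1 h2
      have h3 := zee_const (rel_mem hN hodd hB s0 hij h1 h2) h
      rw [zee_eps] at h3
      exact CharTwo.add_eq_zero.1 h3)
  have hs := key (s - s0).val (by have := ZMod.val_lt (s - s0); omega)
  simpa using hs

lemma tilde_spec {ee : Finset (ZMod N)} {C : Finset (Finset (ZMod N))}
    (h : C ∈ omegaSet (cadj N) ee) :
    tildeF (cadj N) ee C ∈ phiSet (cadj N) ∧ bangF ee (tildeF (cadj N) ee C) = C := by
  have h' : ∃ B ∈ phiSet (cadj N), bangF ee B = C := h
  unfold tildeF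
  rw [dif_pos h']
  exact h'.choose_spec

lemma bang_sub {ee : Finset (ZMod N)} (B : Finset (Finset (ZMod N))) : bangF ee B ⊆ B := by
  unfold bangF
  split_ifs
  · exact Finset.erase_subset _ _
  · exact subset_rfl

lemma preceq_gs (hN : 3 ≤ N) (hodd : Odd N) {ee : Finset (ZMod N)}
    {B' B : Finset (Finset (ZMod N))} (h : preceqO (cadj N) ee (ebar N) B' B) :
    B' ∈ omegaSet (cadj N) ee ∧ B ∈ omegaSet (cadj N) ee ∧
    ∀ s, gs (tildeF (cadj N) ee B') s ≤ gs (tildeF (cadj N) ee B) s := by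
  obtain ⟨k, c, rfl, rfl, hc, hstep⟩ := h
  refine ⟨hc 0 (by omega), hc k le_rfl, ?_⟩
  intro s
  have : ∀ i ≤ k, gs (tildeF (cadj N) ee (c 0)) s ≤ gs (tildeF (cadj N) ee (c i)) s := by
    intro i
    induction i with
    | zero => intro _; exact le_rfl
    | succ i ih =>
      intro hi
      refine (ih (by omega)).trans ?_
      obtain ⟨h1, -⟩ := tilde_spec (hc i (by omega))
      obtain ⟨h3, h4⟩ := tilde_spec (hc (i + 1) hi)
      refine gs_le hN hodd h3 h1 ?_ s
      have h5 := hstep i (by omega)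
      have h6 : c (i + 1) ⊆ tildeF (cadj N) ee (c (i + 1)) := by
        conv_lhs => rw [← h4]
        exact bang_sub _
      exact Submodule.span_mono (Set.image_mono (Finset.coe_subset.2 h6)) h5
  exact this k le_rfl

end fam

/-- `⪯` is a partial order on `omega(Vbar)`. -/
theorem statement17 (N : ℕ) [NeZero N] (hN : 3 ≤ N) (hodd : Odd N)
    (t t' : ZMod N) (hadj : cadj N t t') :
    (∀ B ∈ omegaSet (cadj N) ({t, t'} : Finset (ZMod N)),
      preceqO (cadj N) ({t, t'} : Finset (ZMod N)) (ebar N) B B) ∧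
    (∀ B1 B2 B3 : Finset (Finset (ZMod N)),
      preceqO (cadj N) ({t, t'} : Finset (ZMod N)) (ebar N) B1 B2 →
      preceqO (cadj N) ({t, t'} : Finset (ZMod N)) (ebar N) B2 B3 →
      preceqO (cadj N) ({t, t'} : Finset (ZMod N)) (ebar N) B1 B3) ∧
    (∀ B B' : Finset (Finset (ZMod N)),
      preceqO (cadj N) ({t, t'} : Finset (ZMod N)) (ebar N) B B' →
      preceqO (cadj N) ({t, t'} : Finset (ZMod N)) (ebar N) B' B → B = B') := by
  refine ⟨?_, ?_, ?_⟩
  · intro B hB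
    exact ⟨0, fun _ => B, rfl, rfl, fun _ _ => hB, fun i hi => absurd hi (by omega)⟩
  · rintro B1 B2 B3 ⟨k, c, hc0, hck, hc, hs⟩ ⟨l, d, hd0, hdl, hd, hs'⟩
    refine ⟨k + l, fun i => if i ≤ k then c i else d (i - k), ?_, ?_, ?_, ?_⟩
    · simpa using hc0
    · by_cases hl : l = 0
      · subst hl
        simp [hck, ← hdl, hd0]
      · simp [hl, hdl]
    · intro i hi
      by_cases h : i ≤ k
      · simpa [h] using hc i h
      · simpa [h] using hd (i - k) (by omega)
    · intro i hi
      rcases lt_trichotomy i k with h | h | h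
      · simpa [h.le, Nat.succ_le_of_lt h] using hs i h
      · subst h
        have := hs' 0 (by omega)
        rw [hd0, ← hck] at this
        simpa using this
      · have h1 : ¬ i ≤ k := by omega
        have h2 : ¬ i + 1 ≤ k := by omega
        simp only [h1, h2, if_false]
        rw [show i + 1 - k = i - k + 1 by omega]
        exact hs' (i - k) (by omega)
  · intro B B' h h'
    obtain ⟨hB, hB', h1⟩ := preceq_gs hN hodd h
    obtain ⟨-, -, h2⟩ := preceq_gs hN hodd h'
    obtain ⟨a1, a2⟩ := tilde_spec hB
    obtain ⟨b1, b2⟩ := tilde_spec hB'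
    have hg := fun s => le_antisymm (h1 s) (h2 s)
    have he := (gs_inj_sub hN hodd a1 b1 hg).antisymm
      (gs_inj_sub hN hodd b1 a1 (fun s => (hg s).symm))
    rw [← a2, ← b2, he]
end
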